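/- Logarithmic uncertainty principle for the two-sided QFT: for every f in the quaternion-valued Schwartz space S(ℝ², ℍ), ∫_{ℝ²} ln|x| |f(x)|² dx + ∫_{ℝ²} ln|ω| |F_q f(ω)|² dω ≥ (ψ(1/2) − ln π) ∫_{ℝ²} |f(x)|² dx, where ψ = Γ'/Γ is the digamma function. -/

import Mathlib

open MeasureTheory Real

noncomputable section

/-- The quaternion exponential `e^{iθ} = cos θ + i sin θ`. -/
def expI (θ : ℝ) : Quaternion ℝ := ⟨Real.cos θ, Real.sin θ, 0, 0⟩

/-- The quaternion exponential `e^{jθ} = cos θ + j sin θ`. -/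
def expJ (θ : ℝ) : Quaternion ℝ := ⟨Real.cos θ, 0, Real.sin θ, 0⟩

/-- The two-sided quaternionic Fourier transform
`F_q f (ω) = ∫ e^{-2π i x₁ ω₁} f(x) e^{-2π j x₂ ω₂} dx`. -/
def QFT (f : ℝ × ℝ → Quaternion ℝ) (ω : ℝ × ℝ) : Quaternion ℝ :=
  ∫ x : ℝ × ℝ, expI (-(2 * π * x.1 * ω.1)) * f x * expJ (-(2 * π * x.2 * ω.2))

/-- The two-sided Gabor quaternionic Fourier transform
`G_φ f (ω, b) = ∫ e^{-2π i x₁ ω₁} f(x) conj(φ(x - b)) e^{-2π j x₂ ω₂} dx`. -/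
def GQFT (φ f : ℝ × ℝ → Quaternion ℝ) (ω b : ℝ × ℝ) : Quaternion ℝ :=
  ∫ x : ℝ × ℝ,
    expI (-(2 * π * x.1 * ω.1)) * (f x * star (φ (x - b))) * expJ (-(2 * π * x.2 * ω.2))

/-- The `k`-th coordinate of a point of `ℝ²`. -/
def coord : Fin 2 → ℝ × ℝ → ℝ
  | 0 => Prod.fst
  | 1 => Prod.snd

/-- The `k`-th standard basis direction of `ℝ²`. -/
def dirv : Fin 2 → ℝ × ℝ
  | 0 => (1, 0)
  | 1 => (0, 1)

/-- The Euclidean norm on `ℝ²`. -/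
def euclNorm (x : ℝ × ℝ) : ℝ := Real.sqrt (x.1 ^ 2 + x.2 ^ 2)

/-- squared Euclidean norm -/
def nsq (x : ℝ × ℝ) : ℝ := x.1 ^ 2 + x.2 ^ 2

lemma nsq_nonneg (x : ℝ × ℝ) : 0 ≤ nsq x := by unfold nsq; positivity

lemma nsq_pos {x : ℝ × ℝ} (hx : x ≠ 0) : 0 < nsq x := by
  rcases (nsq_nonneg x).lt_or_eq with h | h
  · exact h
  · exfalso; apply hx
    unfold nsq at h
    have h1 : x.1 = 0 := by nlinarith [sq_nonneg x.1, sq_nonneg x.2]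
    have h2 : x.2 = 0 := by nlinarith [sq_nonneg x.1, sq_nonneg x.2]
    exact Prod.ext h1 h2

@[fun_prop]
lemma continuous_nsq : Continuous nsq := by unfold nsq; fun_prop

@[fun_prop]
lemma measurable_nsq : Measurable nsq := continuous_nsq.measurable

lemma ae_ne_zero : ∀ᵐ x : ℝ × ℝ, x ≠ 0 := by
  have := Measure.ae_ne (volume : Measure (ℝ × ℝ)) 0
  exact this

lemma lint_gamma {a c : ℝ} (ha : 0 < a) (hc : 0 < c) :
    ∫⁻ t in Set.Ioi (0:ℝ), ENNReal.ofReal (t ^ (a - 1) * exp (-(c * t))) =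
      ENNReal.ofReal ((1 / c) ^ a * Gamma a) := by
  have h := integral_rpow_mul_exp_neg_mul_Ioi ha hc
  rw [← h, ofReal_integral_eq_lintegral_ofReal]
  · apply Integrable.of_integral_ne_zero
    rw [h]
    have := Real.Gamma_pos_of_pos ha
    positivity
  · filter_upwards [ae_restrict_mem measurableSet_Ioi] with t ht
    have : (0:ℝ) < t := ht
    show 0 ≤ _
    positivity

lemma lint_scale (g : ℝ → ENNReal) {s : ℝ} (hs : 0 < s) :
    ∫⁻ t in Set.Ioi (0:ℝ), g t =
      ENNReal.ofReal s * ∫⁻ t in Set.Ioi (0:ℝ), g (s * t) := by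
  have h := lintegral_image_eq_lintegral_abs_deriv_mul (s := Set.Ioi (0:ℝ)) (f := fun t => s * t)
    (f' := fun _ => s) measurableSet_Ioi
    (fun x _ => by simpa using ((hasDerivAt_id x).const_mul s).hasDerivWithinAt)
    (fun x _ y _ hxy => mul_left_cancel₀ hs.ne' hxy) g
  have him : (fun t => s * t) '' Set.Ioi (0:ℝ) = Set.Ioi 0 := by
    ext y; constructor
    · rintro ⟨t, ht, rfl⟩; exact mul_pos hs ht
    · intro hy; exact ⟨y / s, div_pos hy hs, by field_simp⟩
  rw [him] at h
  rw [h, abs_of_pos hs, lintegral_const_mul' _ _ ENNReal.ofReal_ne_top]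

lemma lint_beta {a b : ℝ} (ha : 0 < a) (hb : 0 < b) :
    ∫⁻ t in Set.Ioi (0:ℝ), ENNReal.ofReal (t ^ (a - 1) * (1 / (1 + t)) ^ (a + b)) =
      ENNReal.ofReal (Gamma a * Gamma b / Gamma (a + b)) := by
  have hG := Real.Gamma_pos_of_pos (add_pos ha hb)
  have hGa := Real.Gamma_pos_of_pos ha
  have hGb := Real.Gamma_pos_of_pos hb
  have key : ∫⁻ t in Set.Ioi (0:ℝ), ∫⁻ v in Set.Ioi (0:ℝ),
      ENNReal.ofReal (t ^ (a - 1)) * ENNReal.ofReal (v ^ (a + b - 1) * exp (-((1 + t) * v))) =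
      ENNReal.ofReal (Gamma a * Gamma b) := by
    rw [lintegral_lintegral_swap (by
      apply Measurable.aemeasurable; unfold Function.uncurry; fun_prop)]
    have : ∀ v ∈ Set.Ioi (0:ℝ), ∫⁻ t in Set.Ioi (0:ℝ),
        ENNReal.ofReal (t ^ (a - 1)) * ENNReal.ofReal (v ^ (a + b - 1) * exp (-((1 + t) * v)))
        = ENNReal.ofReal (Gamma a) * ENNReal.ofReal (v ^ (b - 1) * exp (-(1 * v))) := by
      intro v hv
      have hv : 0 < v := hv
      have h1 : ∀ t ∈ Set.Ioi (0:ℝ), ENNReal.ofReal (t ^ (a - 1)) *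
          ENNReal.ofReal (v ^ (a + b - 1) * exp (-((1 + t) * v))) =
          ENNReal.ofReal (v ^ (a + b - 1) * exp (-v)) *
            ENNReal.ofReal (t ^ (a - 1) * exp (-(v * t))) := by
        intro t ht
        have ht : 0 < t := ht
        rw [← ENNReal.ofReal_mul (by positivity), ← ENNReal.ofReal_mul (by positivity)]
        congr 1
        rw [show -((1 + t) * v) = -v + -(v * t) by ring, Real.exp_add]; ring
      rw [setLIntegral_congr_fun measurableSet_Ioi h1,
        lintegral_const_mul' _ _ ENNReal.ofReal_ne_top, lint_gamma ha hv,
        ← ENNReal.ofReal_mul (by positivity), ← ENNReal.ofReal_mul (by positivity)]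
      congr 1
      rw [one_mul, one_div, Real.inv_rpow hv.le, ← Real.rpow_neg hv.le,
        show v ^ (b - 1) = v ^ (a + b - 1) * v ^ (-a) by rw [← Real.rpow_add hv]; congr 1; ring]
      ring
    rw [setLIntegral_congr_fun measurableSet_Ioi this,
        lintegral_const_mul' _ _ ENNReal.ofReal_ne_top, lint_gamma hb one_pos,
        ← ENNReal.ofReal_mul (by positivity)]
    simp
  have h2 : ∀ t ∈ Set.Ioi (0:ℝ), ∫⁻ v in Set.Ioi (0:ℝ),
      ENNReal.ofReal (t ^ (a - 1)) * ENNReal.ofReal (v ^ (a + b - 1) * exp (-((1 + t) * v))) =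
      ENNReal.ofReal (Gamma (a + b)) *
        ENNReal.ofReal (t ^ (a - 1) * (1 / (1 + t)) ^ (a + b)) := by
    intro t ht
    have ht : 0 < t := ht
    rw [lintegral_const_mul' _ _ ENNReal.ofReal_ne_top,
      lint_gamma (add_pos ha hb) (by positivity : 0 < 1 + t),
        ← ENNReal.ofReal_mul (by positivity), ← ENNReal.ofReal_mul (by positivity)]
    congr 1; ring
  rw [setLIntegral_congr_fun measurableSet_Ioi h2,
    lintegral_const_mul' _ _ ENNReal.ofReal_ne_top] at key
  rw [ENNReal.ofReal_div_of_pos hG, ← key, mul_comm, ENNReal.mul_div_cancel_right]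
  · simpa using hG
  · simp

lemma gauss_conv1 {s t : ℝ} (hs : 0 < s) (ht : 0 < t) (x : ℝ) :
    ∫⁻ y : ℝ, ENNReal.ofReal (exp (-(π * (x - y) ^ 2 / t)) * exp (-(π * s * y ^ 2))) =
      ENNReal.ofReal (√(t / (1 + t * s)) * exp (-(π * s * x ^ 2 / (1 + t * s)))) := by
  have hp := Real.pi_pos
  have hts : 0 < 1 + t * s := by positivity
  have e : ∀ y : ℝ, exp (-(π * (x - y) ^ 2 / t)) * exp (-(π * s * y ^ 2)) =
      exp (-(π * s * x ^ 2 / (1 + t * s))) *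
        exp (-(π * (1 + t * s) / t) * (y - x / (1 + t * s)) ^ 2) := by
    intro y
    rw [← Real.exp_add, ← Real.exp_add]
    congr 1
    field_simp
    ring
  simp_rw [e]
  have hb : 0 < π * (1 + t * s) / t := by positivity
  rw [← ofReal_integral_eq_lintegral_ofReal]
  · rw [integral_const_mul,
      integral_sub_right_eq_self (fun y => exp (-(π * (1 + t * s) / t) * y ^ 2)),
      integral_gaussian, mul_comm]
    congr 3
    field_simp
  · exact ((integrable_exp_neg_mul_sq hb).comp_sub_right _).const_mul _
  · exact Filter.Eventually.of_forall fun y => by positivity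

lemma gauss_conv2 {s t : ℝ} (hs : 0 < s) (ht : 0 < t) (x : ℝ × ℝ) :
    ∫⁻ y : ℝ × ℝ, ENNReal.ofReal (exp (-(π * nsq (x - y) / t)) * exp (-(π * s * nsq y))) =
      ENNReal.ofReal (t / (1 + t * s) * exp (-(π * s * nsq x / (1 + t * s)))) := by
  have hts : 0 < 1 + t * s := by positivity
  have e : ∀ y : ℝ × ℝ,
      ENNReal.ofReal (exp (-(π * nsq (x - y) / t)) * exp (-(π * s * nsq y))) =
      ENNReal.ofReal (exp (-(π * (x.1 - y.1) ^ 2 / t)) * exp (-(π * s * y.1 ^ 2))) *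
      ENNReal.ofReal (exp (-(π * (x.2 - y.2) ^ 2 / t)) * exp (-(π * s * y.2 ^ 2))) := by
    intro y
    rw [← ENNReal.ofReal_mul (by positivity)]
    congr 1
    simp only [← Real.exp_add, nsq, Prod.fst_sub, Prod.snd_sub]
    congr 1; ring
  simp_rw [e]
  rw [Measure.volume_eq_prod, lintegral_prod_mul
    (f := fun u : ℝ => ENNReal.ofReal (exp (-(π * (x.1 - u) ^ 2 / t)) * exp (-(π * s * u ^ 2))))
    (g := fun u : ℝ => ENNReal.ofReal (exp (-(π * (x.2 - u) ^ 2 / t)) * exp (-(π * s * u ^ 2))))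
    (by fun_prop) (by fun_prop)]
  rw [gauss_conv1 hs ht, gauss_conv1 hs ht, ← ENNReal.ofReal_mul (by positivity)]
  congr 1
  rw [mul_mul_mul_comm, Real.mul_self_sqrt (by positivity), ← Real.exp_add]
  congr 2; simp only [nsq]; ring

lemma lint_inv_norm {n : ℝ} (hn : 0 < n) :
    ENNReal.ofReal (n ^ (-(1/2) : ℝ)) =
      ∫⁻ s in Set.Ioi (0:ℝ), ENNReal.ofReal (s ^ ((1/2 : ℝ) - 1) * exp (-(π * n * s))) := by
  rw [lint_gamma (by norm_num) (by positivity), Real.Gamma_one_half_eq]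
  congr 1
  rw [one_div (π * n), mul_inv, Real.mul_rpow (by positivity) (by positivity),
    Real.inv_rpow (by positivity), Real.inv_rpow (by positivity), Real.sqrt_eq_rpow,
    Real.rpow_neg hn.le]
  have : (0:ℝ) < π ^ (1/2 : ℝ) := by positivity
  field_simp

/-- The constant in the Schur test. -/
lemma schur_const {a : ℝ} (ha : 0 < a) (ha2 : a < 1/2) {x : ℝ × ℝ} (hx : x ≠ 0) :
    ∫⁻ t in Set.Ioi (0:ℝ), ∫⁻ y : ℝ × ℝ,
      ENNReal.ofReal (t ^ (a - 1)) * (ENNReal.ofReal (t⁻¹ * exp (-(π * nsq (x - y) / t))) *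
        ENNReal.ofReal (nsq y ^ (-(1/2) : ℝ))) =
    ENNReal.ofReal (Gamma a * π ^ a * (Gamma (1/2 - a) / Gamma (1/2 + a)) *
      nsq x ^ (a - 1/2)) := by
  have hn := nsq_pos hx
  have hp := Real.pi_pos
  -- step 1
  have s1 : ∀ t ∈ Set.Ioi (0:ℝ), ∫⁻ y : ℝ × ℝ,
      ENNReal.ofReal (t ^ (a - 1)) * (ENNReal.ofReal (t⁻¹ * exp (-(π * nsq (x - y) / t))) *
        ENNReal.ofReal (nsq y ^ (-(1/2) : ℝ))) = ∫⁻ s in Set.Ioi (0:ℝ),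
      ENNReal.ofReal (t ^ (a - 1) * s ^ ((1/2 : ℝ) - 1) *
        (1 / (1 + t * s) * exp (-(π * s * nsq x / (1 + t * s))))) := by
    intro t ht
    have ht : 0 < t := ht
    have e1 : ∫⁻ y : ℝ × ℝ,
      ENNReal.ofReal (t ^ (a - 1)) * (ENNReal.ofReal (t⁻¹ * exp (-(π * nsq (x - y) / t))) *
        ENNReal.ofReal (nsq y ^ (-(1/2) : ℝ))) = ∫⁻ y : ℝ × ℝ, ∫⁻ s in Set.Ioi (0:ℝ),
        ENNReal.ofReal (t ^ (a - 1) * t⁻¹) * (ENNReal.ofReal (s ^ ((1/2 : ℝ) - 1)) *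
          ENNReal.ofReal (exp (-(π * nsq (x - y) / t)) * exp (-(π * s * nsq y)))) := by
      apply lintegral_congr_ae
      filter_upwards [ae_ne_zero] with y hy
      rw [lint_inv_norm (nsq_pos hy), ← mul_assoc, ← ENNReal.ofReal_mul (by positivity),
        ← lintegral_const_mul' _ _ ENNReal.ofReal_ne_top]
      apply setLIntegral_congr_fun measurableSet_Ioi
      intro s hs
      have hs : 0 < s := hs
      simp only
      rw [← ENNReal.ofReal_mul (by positivity), ← ENNReal.ofReal_mul (by positivity),
        ← ENNReal.ofReal_mul (by positivity)]
      congr 1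
      rw [show π * s * nsq y = π * nsq y * s by ring]
      ring
    rw [e1, lintegral_lintegral_swap (by
      apply Measurable.aemeasurable; unfold Function.uncurry; fun_prop)]
    apply setLIntegral_congr_fun measurableSet_Ioi
    intro s hs
    have hs : 0 < s := hs
    simp only
    rw [lintegral_const_mul' _ _ ENNReal.ofReal_ne_top,
      lintegral_const_mul' _ _ ENNReal.ofReal_ne_top, gauss_conv2 hs ht,
      ← ENNReal.ofReal_mul (by positivity), ← ENNReal.ofReal_mul (by positivity)]
    congr 1
    field_simp
  rw [setLIntegral_congr_fun measurableSet_Ioi s1, lintegral_lintegral_swap (by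
      apply Measurable.aemeasurable; unfold Function.uncurry; fun_prop)]
  have s2 : ∀ s ∈ Set.Ioi (0:ℝ), ∫⁻ t in Set.Ioi (0:ℝ),
      ENNReal.ofReal (t ^ (a - 1) * s ^ ((1/2 : ℝ) - 1) *
        (1 / (1 + t * s) * exp (-(π * s * nsq x / (1 + t * s))))) =
      ∫⁻ τ in Set.Ioi (0:ℝ), ENNReal.ofReal (τ ^ (a - 1) * (1 / (1 + τ))) *
        ENNReal.ofReal (s ^ ((1/2 - a) - 1) * exp (-(π * nsq x / (1 + τ) * s))) := by
    intro s hs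
    have hs : 0 < s := hs
    rw [lint_scale _ (inv_pos.mpr hs), ← lintegral_const_mul' _ _ ENNReal.ofReal_ne_top]
    apply setLIntegral_congr_fun measurableSet_Ioi
    intro τ hτ
    have hτ : 0 < τ := hτ
    simp only
    rw [← ENNReal.ofReal_mul (by positivity), ← ENNReal.ofReal_mul (by positivity)]
    congr 1
    rw [show s⁻¹ * τ * s = τ by field_simp, Real.mul_rpow (by positivity) hτ.le,
      show s ^ ((1/2 - a) - 1) = s⁻¹ * (s⁻¹ ^ (a - 1) * s ^ ((1/2:ℝ) - 1)) by
        rw [Real.inv_rpow hs.le, ← Real.rpow_neg hs.le, ← Real.rpow_neg_one s,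
          ← Real.rpow_add hs, ← Real.rpow_add hs]
        congr 1; ring,
      show π * s * nsq x / (1 + τ) = π * nsq x / (1 + τ) * s by ring]
    ring
  rw [setLIntegral_congr_fun measurableSet_Ioi s2, lintegral_lintegral_swap (by
      apply Measurable.aemeasurable; unfold Function.uncurry; fun_prop)]
  have hG1 := Real.Gamma_pos_of_pos (by linarith : 0 < 1/2 - a)
  have hG2 := Real.Gamma_pos_of_pos (by linarith : 0 < 1/2 + a)
  have hG3 := Real.Gamma_pos_of_pos ha
  have s3 : ∀ τ ∈ Set.Ioi (0:ℝ), ∫⁻ s in Set.Ioi (0:ℝ),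
      ENNReal.ofReal (τ ^ (a - 1) * (1 / (1 + τ))) *
        ENNReal.ofReal (s ^ ((1/2 - a) - 1) * exp (-(π * nsq x / (1 + τ) * s))) =
      ENNReal.ofReal (Gamma (1/2 - a) * (π * nsq x) ^ (a - 1/2)) *
        ENNReal.ofReal (τ ^ (a - 1) * (1 / (1 + τ)) ^ (a + 1/2)) := by
    intro τ hτ
    have hτ : 0 < τ := hτ
    have h1 : 0 < 1 + τ := by positivity
    rw [lintegral_const_mul' _ _ ENNReal.ofReal_ne_top,
      lint_gamma (by linarith) (by positivity),
      ← ENNReal.ofReal_mul (by positivity), ← ENNReal.ofReal_mul (by positivity)]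
    congr 1
    rw [show 1 / (π * nsq x / (1 + τ)) = (π * nsq x)⁻¹ * (1 + τ) by field_simp,
      Real.mul_rpow (by positivity) h1.le, Real.inv_rpow (by positivity),
      ← Real.rpow_neg (by positivity), one_div, Real.inv_rpow h1.le, ← Real.rpow_neg h1.le,
      show -(a + 1/2) = (-1) + (1/2 - a) by ring, Real.rpow_add h1, Real.rpow_neg_one,
      show -(1/2 - a) = a - 1/2 by ring]
    ring
  rw [setLIntegral_congr_fun measurableSet_Ioi s3,
    lintegral_const_mul' _ _ ENNReal.ofReal_ne_top, lint_beta ha (by norm_num),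
    ← ENNReal.ofReal_mul (by positivity), Real.Gamma_one_half_eq]
  congr 1
  rw [Real.mul_rpow hp.le hn.le, Real.rpow_sub hp, ← Real.sqrt_eq_rpow, add_comm a]
  have : (0:ℝ) < √π := by positivity
  field_simp

lemma norm_expI (θ : ℝ) : ‖expI θ‖ = 1 := by
  have h : ‖expI θ‖ * ‖expI θ‖ = 1 := by
    rw [← Quaternion.normSq_eq_norm_mul_self, Quaternion.normSq_def']
    simp [expI]
  nlinarith [norm_nonneg (expI θ)]

lemma norm_expJ (θ : ℝ) : ‖expJ θ‖ = 1 := by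
  have h : ‖expJ θ‖ * ‖expJ θ‖ = 1 := by
    rw [← Quaternion.normSq_eq_norm_mul_self, Quaternion.normSq_def']
    simp [expJ]
  nlinarith [norm_nonneg (expJ θ)]

/-- the unit i -/
def qi : Quaternion ℝ := ⟨0, 1, 0, 0⟩
/-- the unit j -/
def qj : Quaternion ℝ := ⟨0, 0, 1, 0⟩

lemma re_qi : qi.re = 0 := rfl
lemma imI_qi : qi.imI = 1 := rfl
lemma imJ_qi : qi.imJ = 0 := rfl
lemma imK_qi : qi.imK = 0 := rfl
lemma re_qj : qj.re = 0 := rfl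
lemma imI_qj : qj.imI = 0 := rfl
lemma imJ_qj : qj.imJ = 1 := rfl
lemma imK_qj : qj.imK = 0 := rfl
lemma re_expI (θ : ℝ) : (expI θ).re = Real.cos θ := rfl
lemma imI_expI (θ : ℝ) : (expI θ).imI = Real.sin θ := rfl
lemma imJ_expI (θ : ℝ) : (expI θ).imJ = 0 := rfl
lemma imK_expI (θ : ℝ) : (expI θ).imK = 0 := rfl
lemma re_expJ (θ : ℝ) : (expJ θ).re = Real.cos θ := rfl
lemma imI_expJ (θ : ℝ) : (expJ θ).imI = 0 := rfl
lemma imJ_expJ (θ : ℝ) : (expJ θ).imJ = Real.sin θ := rfl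
lemma imK_expJ (θ : ℝ) : (expJ θ).imK = 0 := rfl

lemma expI_eq (θ : ℝ) : expI θ = Real.cos θ • (1 : Quaternion ℝ) + Real.sin θ • qi := by
  ext <;> simp [re_expI, imI_expI, imJ_expI, imK_expI, re_qi, imI_qi, imJ_qi, imK_qi,
    Quaternion.re_one, Quaternion.imI_one, Quaternion.imJ_one, Quaternion.imK_one]

lemma expJ_eq (θ : ℝ) : expJ θ = Real.cos θ • (1 : Quaternion ℝ) + Real.sin θ • qj := by
  ext <;> simp [re_expJ, imI_expJ, imJ_expJ, imK_expJ, re_qj, imI_qj, imJ_qj, imK_qj,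
    Quaternion.re_one, Quaternion.imI_one, Quaternion.imJ_one, Quaternion.imK_one]

@[fun_prop]
lemma continuous_expI : Continuous expI := by
  have : expI = fun θ => Real.cos θ • (1 : Quaternion ℝ) + Real.sin θ • qi := funext expI_eq
  rw [this]; fun_prop

@[fun_prop]
lemma continuous_expJ : Continuous expJ := by
  have : expJ = fun θ => Real.cos θ • (1 : Quaternion ℝ) + Real.sin θ • qj := funext expJ_eq
  rw [this]; fun_prop

/-- integrand of the QFT -/
def ker (f : ℝ × ℝ → Quaternion ℝ) (ω x : ℝ × ℝ) : Quaternion ℝ :=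
  expI (-(2 * π * x.1 * ω.1)) * f x * expJ (-(2 * π * x.2 * ω.2))

lemma norm_ker (f : ℝ × ℝ → Quaternion ℝ) (ω x : ℝ × ℝ) : ‖ker f ω x‖ = ‖f x‖ := by
  simp [ker, norm_expI, norm_expJ]

lemma inner_exp (p q : Quaternion ℝ) : ∃ c2 c3 c4 : ℝ, ∀ A B C D : ℝ,
    inner ℝ (expI (-A) * p * expJ (-B)) (expI (-C) * q * expJ (-D)) =
      inner ℝ p q * (Real.cos (A - C) * Real.cos (B - D)) +
      c2 * (Real.cos (A - C) * Real.sin (B - D)) + c3 * (Real.sin (A - C) * Real.cos (B - D)) +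
      c4 * (Real.sin (A - C) * Real.sin (B - D)) := by
  refine ⟨-inner ℝ (p * qj) q, -inner ℝ (qi * p) q, inner ℝ (qi * p * qj) q, ?_⟩
  intro A B C D
  simp only [Quaternion.inner_def, Quaternion.re_mul, Quaternion.imI_mul,
    Quaternion.imJ_mul, Quaternion.imK_mul, Quaternion.re_star, Quaternion.imI_star,
    Quaternion.imJ_star, Quaternion.imK_star, Real.cos_sub,
    Real.sin_sub, re_expI, imI_expI, imJ_expI, imK_expI, re_qi, imI_qi, imJ_qi, imK_qi,
    re_expJ, imI_expJ, imJ_expJ, imK_expJ, re_qj, imI_qj, imJ_qj, imK_qj,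
    Real.cos_neg, Real.sin_neg]
  ring

lemma gauss_integrable {t : ℝ} (ht : 0 < t) : Integrable (fun w : ℝ => exp (-(π * t * w ^ 2))) := by
  have := integrable_exp_neg_mul_sq (b := π * t) (by positivity)
  simpa only [neg_mul] using this

lemma gauss_cos {t : ℝ} (ht : 0 < t) (a : ℝ) :
    ∫ w : ℝ, exp (-(π * t * w ^ 2)) * Real.cos (2 * π * a * w) =
      (√t)⁻¹ * exp (-(π * a ^ 2 / t)) := by
  have hp := Real.pi_pos
  have h := fourierIntegral_gaussian (b := ((π * t : ℝ) : ℂ)) (by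
    rw [Complex.ofReal_re]; positivity) ((2 * π * a : ℝ) : ℂ)
  have hI : Integrable (fun w : ℝ => Complex.exp (Complex.I * ((2 * π * a : ℝ) : ℂ) * (w : ℂ)) *
      Complex.exp (-((π * t : ℝ) : ℂ) * (w : ℂ) ^ 2)) := by
    apply Integrable.of_integral_ne_zero
    rw [h]
    refine mul_ne_zero ?_ (Complex.exp_ne_zero _)
    rw [Complex.cpow_ne_zero_iff]
    left
    refine div_ne_zero (by exact_mod_cast hp.ne') (by exact_mod_cast (by positivity))
  have h2 := congrArg Complex.re h
  have h3 : (∫ w : ℝ, Complex.exp (Complex.I * ((2 * π * a : ℝ) : ℂ) * (w : ℂ)) *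
      Complex.exp (-((π * t : ℝ) : ℂ) * (w : ℂ) ^ 2)).re =
      ∫ w : ℝ, (Complex.exp (Complex.I * ((2 * π * a : ℝ) : ℂ) * (w : ℂ)) *
      Complex.exp (-((π * t : ℝ) : ℂ) * (w : ℂ) ^ 2)).re := (integral_re hI).symm
  rw [h3] at h2
  have h4 : ∀ w : ℝ, (Complex.exp (Complex.I * ((2 * π * a : ℝ) : ℂ) * (w : ℂ)) *
      Complex.exp (-((π * t : ℝ) : ℂ) * (w : ℂ) ^ 2)).re =
      exp (-(π * t * w ^ 2)) * Real.cos (2 * π * a * w) := by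
    intro w
    rw [show Complex.I * ((2 * π * a : ℝ) : ℂ) * (w : ℂ) = ((2 * π * a * w : ℝ) : ℂ) * Complex.I by
      push_cast; ring, show -((π * t : ℝ) : ℂ) * (w : ℂ) ^ 2 = ((-(π * t * w ^ 2) : ℝ) : ℂ) by
      push_cast; ring, ← Complex.ofReal_exp, Complex.re_mul_ofReal, Complex.exp_ofReal_mul_I_re,
      mul_comm]
  simp_rw [h4] at h2
  rw [h2]
  rw [show (π : ℂ) / ((π * t : ℝ) : ℂ) = ((t⁻¹ : ℝ) : ℂ) by
      rw [← Complex.ofReal_div]; congr 1; field_simp,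
    show -((2 * π * a : ℝ) : ℂ) ^ 2 / (4 * ((π * t : ℝ) : ℂ)) = ((-(π * a ^ 2 / t) : ℝ) : ℂ) by
      have : (π : ℂ) ≠ 0 := by exact_mod_cast hp.ne'
      have : (t : ℂ) ≠ 0 := by exact_mod_cast ht.ne'
      push_cast; field_simp; ring,
    show (1 / 2 : ℂ) = ((1 / 2 : ℝ) : ℂ) by push_cast; rfl,
    ← Complex.ofReal_cpow (by positivity), ← Complex.ofReal_exp, ← Complex.ofReal_mul,
    Complex.ofReal_re, Real.inv_rpow ht.le, ← Real.sqrt_eq_rpow]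

lemma gauss_sin (t a : ℝ) :
    ∫ w : ℝ, exp (-(π * t * w ^ 2)) * Real.sin (2 * π * a * w) = 0 := by
  have h := integral_neg_eq_self (fun w : ℝ => exp (-(π * t * w ^ 2)) * Real.sin (2 * π * a * w))
    volume
  simp only [mul_neg, Real.sin_neg, neg_sq, integral_neg] at h
  linarith

lemma gauss_prod_int {t : ℝ} (ht : 0 < t) {u v : ℝ → ℝ} (hu : Continuous u) (hv : Continuous v)
    (hu1 : ∀ x, |u x| ≤ 1) (hv1 : ∀ x, |v x| ≤ 1) :
    Integrable (fun w : ℝ × ℝ => (exp (-(π * t * w.1 ^ 2)) * u w.1) *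
      (exp (-(π * t * w.2 ^ 2)) * v w.2)) := by
  have key : ∀ g : ℝ → ℝ, Continuous g → (∀ x, |g x| ≤ 1) →
      Integrable (fun w : ℝ => exp (-(π * t * w ^ 2)) * g w) := by
    intro g hg hg1
    refine (gauss_integrable ht).mono' (by fun_prop) (Filter.Eventually.of_forall fun w => ?_)
    rw [norm_mul, Real.norm_eq_abs, Real.norm_eq_abs, abs_of_pos (Real.exp_pos _)]
    exact mul_le_of_le_one_right (Real.exp_pos _).le (hg1 w)
  exact (key u hu hu1).mul_prod (key v hv hv1)

lemma gauss_prod (t : ℝ) (u v : ℝ → ℝ) :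
    ∫ w : ℝ × ℝ, (exp (-(π * t * w.1 ^ 2)) * u w.1) * (exp (-(π * t * w.2 ^ 2)) * v w.2) =
      (∫ w : ℝ, exp (-(π * t * w ^ 2)) * u w) * ∫ w : ℝ, exp (-(π * t * w ^ 2)) * v w :=
  integral_prod_mul (fun w : ℝ => exp (-(π * t * w ^ 2)) * u w)
    (fun w : ℝ => exp (-(π * t * w ^ 2)) * v w)

lemma gauss_inner {t : ℝ} (ht : 0 < t) (f : ℝ × ℝ → Quaternion ℝ) (x y : ℝ × ℝ) :
    ∫ ω : ℝ × ℝ, exp (-(π * t * nsq ω)) * inner ℝ (ker f ω x) (ker f ω y) =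
      t⁻¹ * exp (-(π * nsq (x - y) / t)) * inner ℝ (f x) (f y) := by
  obtain ⟨c2, c3, c4, h⟩ := inner_exp (f x) (f y)
  have e : ∀ ω : ℝ × ℝ, exp (-(π * t * nsq ω)) * inner ℝ (ker f ω x) (ker f ω y) =
      inner ℝ (f x) (f y) * ((exp (-(π * t * ω.1 ^ 2)) * Real.cos (2 * π * (x.1 - y.1) * ω.1)) *
        (exp (-(π * t * ω.2 ^ 2)) * Real.cos (2 * π * (x.2 - y.2) * ω.2))) +
      c2 * ((exp (-(π * t * ω.1 ^ 2)) * Real.cos (2 * π * (x.1 - y.1) * ω.1)) *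
        (exp (-(π * t * ω.2 ^ 2)) * Real.sin (2 * π * (x.2 - y.2) * ω.2))) +
      c3 * ((exp (-(π * t * ω.1 ^ 2)) * Real.sin (2 * π * (x.1 - y.1) * ω.1)) *
        (exp (-(π * t * ω.2 ^ 2)) * Real.cos (2 * π * (x.2 - y.2) * ω.2))) +
      c4 * ((exp (-(π * t * ω.1 ^ 2)) * Real.sin (2 * π * (x.1 - y.1) * ω.1)) *
        (exp (-(π * t * ω.2 ^ 2)) * Real.sin (2 * π * (x.2 - y.2) * ω.2))) := by
    intro ω
    unfold ker
    rw [h, show π * t * nsq ω = π * t * ω.1 ^ 2 + π * t * ω.2 ^ 2 by unfold nsq; ring, neg_add,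
      Real.exp_add,
      show 2 * π * x.1 * ω.1 - 2 * π * y.1 * ω.1 = 2 * π * (x.1 - y.1) * ω.1 by ring,
      show 2 * π * x.2 * ω.2 - 2 * π * y.2 * ω.2 = 2 * π * (x.2 - y.2) * ω.2 by ring]
    ring
  simp_rw [e]
  have hc : ∀ a : ℝ, Continuous fun w : ℝ => Real.cos (2 * π * a * w) := fun a => by fun_prop
  have hs : ∀ a : ℝ, Continuous fun w : ℝ => Real.sin (2 * π * a * w) := fun a => by fun_prop
  have i1 := (gauss_prod_int ht (hc (x.1 - y.1)) (hc (x.2 - y.2))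
    (fun _ => Real.abs_cos_le_one _) (fun _ => Real.abs_cos_le_one _)).const_mul
      (inner ℝ (f x) (f y))
  have i2 := (gauss_prod_int ht (hc (x.1 - y.1)) (hs (x.2 - y.2))
    (fun _ => Real.abs_cos_le_one _) (fun _ => Real.abs_sin_le_one _)).const_mul c2
  have i3 := (gauss_prod_int ht (hs (x.1 - y.1)) (hc (x.2 - y.2))
    (fun _ => Real.abs_sin_le_one _) (fun _ => Real.abs_cos_le_one _)).const_mul c3
  have i4 := (gauss_prod_int ht (hs (x.1 - y.1)) (hs (x.2 - y.2))
    (fun _ => Real.abs_sin_le_one _) (fun _ => Real.abs_sin_le_one _)).const_mul c4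
  have i12 := i1.add i2
  have i123 := i12.add i3
  erw [integral_add i123 i4]
  simp only [Pi.add_apply]
  erw [integral_add i12 i3]
  simp only [Pi.add_apply]
  rw [integral_add i1 i2]
  simp only [integral_const_mul]
  rw [gauss_prod t (fun w => Real.cos (2 * π * (x.1 - y.1) * w))
      (fun w => Real.cos (2 * π * (x.2 - y.2) * w)),
    gauss_prod t (fun w => Real.cos (2 * π * (x.1 - y.1) * w))
      (fun w => Real.sin (2 * π * (x.2 - y.2) * w)),
    gauss_prod t (fun w => Real.sin (2 * π * (x.1 - y.1) * w))
      (fun w => Real.cos (2 * π * (x.2 - y.2) * w)),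
    gauss_prod t (fun w => Real.sin (2 * π * (x.1 - y.1) * w))
      (fun w => Real.sin (2 * π * (x.2 - y.2) * w))]
  simp only [gauss_cos ht, gauss_sin]
  have h1 : (√t)⁻¹ * (√t)⁻¹ = t⁻¹ := by rw [← mul_inv, Real.mul_self_sqrt ht.le]
  rw [← h1, show -(π * nsq (x - y) / t) =
    -(π * (x.1 - y.1) ^ 2 / t) + -(π * (x.2 - y.2) ^ 2 / t) by
      simp only [nsq, Prod.fst_sub, Prod.snd_sub]; ring, Real.exp_add]
  ring

lemma gauss2_integrable {t : ℝ} (ht : 0 < t) :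
    Integrable (fun w : ℝ × ℝ => exp (-(π * t * nsq w))) := by
  have := (gauss_integrable ht).mul_prod (gauss_integrable ht)
  refine this.congr (Filter.Eventually.of_forall fun w => ?_)
  simp only
  rw [← Real.exp_add]; congr 1; unfold nsq; ring

lemma ker_cont {X : Type*} [TopologicalSpace X] (f : SchwartzMap (ℝ × ℝ) (Quaternion ℝ))
    {u v : X → ℝ × ℝ} (hu : Continuous u) (hv : Continuous v) :
    Continuous (fun z : X => ker f (u z) (v z)) := by
  have hf : Continuous fun z => f (v z) := f.continuous.comp hv
  unfold ker
  fun_prop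

lemma ker_integrable (f : SchwartzMap (ℝ × ℝ) (Quaternion ℝ)) (ω : ℝ × ℝ) :
    Integrable (fun x => ker f ω x) := by
  refine f.integrable.norm.mono' (ker_cont f continuous_const continuous_id).aestronglyMeasurable
    (Filter.Eventually.of_forall fun x => ?_)
  rw [norm_ker]

lemma qft_norm_sq (f : SchwartzMap (ℝ × ℝ) (Quaternion ℝ)) (ω : ℝ × ℝ) :
    ‖QFT f ω‖ ^ 2 = ∫ z : (ℝ × ℝ) × (ℝ × ℝ), inner ℝ (ker f ω z.1) (ker f ω z.2) := by
  have hI := ker_integrable f ω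
  have hprod : Integrable (fun z : (ℝ × ℝ) × (ℝ × ℝ) => inner ℝ (ker f ω z.1) (ker f ω z.2))
      (volume.prod volume) := by
    refine (hI.norm.mul_prod hI.norm).mono' (Continuous.aestronglyMeasurable
        ((ker_cont f continuous_const continuous_fst).inner
          (ker_cont f continuous_const continuous_snd)))
      (Filter.Eventually.of_forall fun z => norm_inner_le_norm _ _)
  rw [Measure.volume_eq_prod, integral_prod _ hprod]
  simp only
  simp_rw [integral_inner hI]
  have : ∀ x, inner ℝ (ker f ω x) (∫ y, ker f ω y) = inner ℝ (∫ y, ker f ω y) (ker f ω x) :=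
    fun x => real_inner_comm _ _
  simp_rw [this]
  rw [integral_inner hI, real_inner_self_eq_norm_sq]
  rfl

lemma ff_integrable (f : SchwartzMap (ℝ × ℝ) (Quaternion ℝ)) :
    Integrable (fun z : (ℝ × ℝ) × (ℝ × ℝ) => ‖f z.1‖ * ‖f z.2‖) :=
  f.integrable.norm.mul_prod f.integrable.norm

lemma triple_integrable (f : SchwartzMap (ℝ × ℝ) (Quaternion ℝ)) {t : ℝ} (ht : 0 < t) :
    Integrable (Function.uncurry fun (ω : ℝ × ℝ) (z : (ℝ × ℝ) × (ℝ × ℝ)) =>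
      exp (-(π * t * nsq ω)) * inner ℝ (ker f ω z.1) (ker f ω z.2)) (volume.prod volume) := by
  refine ((gauss2_integrable ht).mul_prod (ff_integrable f)).mono'
    (Continuous.aestronglyMeasurable ?_) (Filter.Eventually.of_forall fun p => ?_)
  · unfold Function.uncurry
    refine Continuous.mul (by fun_prop) (Continuous.inner (ker_cont f ?_ ?_) (ker_cont f ?_ ?_)) <;>
    fun_prop
  · simp only [Function.uncurry]
    rw [norm_mul, Real.norm_of_nonneg (Real.exp_pos _).le]
    gcongr
    refine (norm_inner_le_norm _ _).trans ?_
    rw [norm_ker, norm_ker]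

lemma gauss_qft (f : SchwartzMap (ℝ × ℝ) (Quaternion ℝ)) {t : ℝ} (ht : 0 < t) :
    Integrable (fun ω => exp (-(π * t * nsq ω)) * ‖QFT f ω‖ ^ 2) ∧
    Integrable (fun z : (ℝ × ℝ) × (ℝ × ℝ) =>
      t⁻¹ * exp (-(π * nsq (z.1 - z.2) / t)) * inner ℝ (f z.1) (f z.2)) ∧
    ∫ ω, exp (-(π * t * nsq ω)) * ‖QFT f ω‖ ^ 2 = ∫ z : (ℝ × ℝ) × (ℝ × ℝ),
      t⁻¹ * exp (-(π * nsq (z.1 - z.2) / t)) * inner ℝ (f z.1) (f z.2) := by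
  have hT := triple_integrable f ht
  refine ⟨?_, ?_, ?_⟩
  · have := hT.integral_prod_left
    simpa only [Function.uncurry, integral_const_mul, ← qft_norm_sq] using this
  · have := hT.integral_prod_right
    simpa only [Function.uncurry, gauss_inner ht] using this
  · have := integral_integral_swap hT
    simpa only [integral_const_mul, ← qft_norm_sq, gauss_inner ht] using this

lemma qft_cont (f : SchwartzMap (ℝ × ℝ) (Quaternion ℝ)) : Continuous (fun ω => QFT f ω) := by
  show Continuous fun ω => ∫ x, ker f ω x
  refine continuous_of_dominated (bound := fun x => ‖f x‖) ?_ ?_ f.integrable.norm ?_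
  · intro ω
    exact (ker_integrable f ω).aestronglyMeasurable
  · intro ω
    exact Filter.Eventually.of_forall fun x => (norm_ker f ω x).le
  · exact Filter.Eventually.of_forall fun x => ker_cont f continuous_id continuous_const

/-- weighted kernel -/
def wk (f : ℝ × ℝ → Quaternion ℝ) (t : ℝ) (x y : ℝ × ℝ) : ENNReal :=
  ENNReal.ofReal (‖f x‖ ^ 2 * nsq x ^ (1/2 : ℝ)) *
    (ENNReal.ofReal (t⁻¹ * exp (-(π * nsq (x - y) / t))) * ENNReal.ofReal (nsq y ^ (-(1/2) : ℝ)))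

lemma wk_meas {X : Type*} [MeasurableSpace X] (f : SchwartzMap (ℝ × ℝ) (Quaternion ℝ))
    {t : X → ℝ} {u v : X → ℝ × ℝ} (ht : Measurable t) (hu : Measurable u) (hv : Measurable v) :
    Measurable (fun p : X => wk f (t p) (u p) (v p)) := by
  have hf : Measurable fun p => ‖f (u p)‖ := f.continuous.norm.measurable.comp hu
  unfold wk
  fun_prop

lemma nsq_sub_comm (x y : ℝ × ℝ) : nsq (x - y) = nsq (y - x) := by
  simp only [nsq, Prod.fst_sub, Prod.snd_sub]; ring

lemma amgm (f : ℝ × ℝ → Quaternion ℝ) {t : ℝ} (ht : 0 < t) {x y : ℝ × ℝ} (hx : x ≠ 0)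
    (hy : y ≠ 0) :
    ENNReal.ofReal (t⁻¹ * exp (-(π * nsq (x - y) / t)) * (‖f x‖ * ‖f y‖)) ≤
      ENNReal.ofReal (1/2) * wk f t x y + ENNReal.ofReal (1/2) * wk f t y x := by
  have h1 := nsq_pos hx
  have h2 := nsq_pos hy
  unfold wk
  rw [nsq_sub_comm y x]
  set G := t⁻¹ * exp (-(π * nsq (x - y) / t)) with hG
  have hG0 : 0 < G := by positivity
  simp only [← ENNReal.ofReal_mul (by positivity : (0:ℝ) ≤ G)]
  rw [← ENNReal.ofReal_mul (by positivity), ← ENNReal.ofReal_mul (by positivity),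
    ← ENNReal.ofReal_mul (by positivity), ← ENNReal.ofReal_mul (by positivity),
    ← ENNReal.ofReal_add (by positivity) (by positivity)]
  apply ENNReal.ofReal_le_ofReal
  rw [Real.rpow_neg h1.le, Real.rpow_neg h2.le]
  set A := nsq x ^ (1/2 : ℝ) with hA
  set B := nsq y ^ (1/2 : ℝ) with hB
  have hA0 : 0 < A := by positivity
  have hB0 : 0 < B := by positivity
  have : 1/2 * (‖f x‖ ^ 2 * A * (G * B⁻¹)) + 1/2 * (‖f y‖ ^ 2 * B * (G * A⁻¹)) -
      G * (‖f x‖ * ‖f y‖) = G * (1/2) * (‖f x‖ * A - ‖f y‖ * B) ^ 2 / (A * B) := by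
    field_simp
    ring
  have : 0 ≤ G * (1/2) * (‖f x‖ * A - ‖f y‖ * B) ^ 2 / (A * B) := by positivity
  linarith

lemma gauss_qft_le (f : SchwartzMap (ℝ × ℝ) (Quaternion ℝ)) {t : ℝ} (ht : 0 < t) :
    ∫⁻ ω, ENNReal.ofReal (exp (-(π * t * nsq ω)) * ‖QFT f ω‖ ^ 2) ≤
      ∫⁻ x, ∫⁻ y, wk f t x y := by
  obtain ⟨hI1, hI2, hE⟩ := gauss_qft f ht
  rw [← ofReal_integral_eq_lintegral_ofReal hI1 (Filter.Eventually.of_forall fun ω => by positivity),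
    hE]
  have hI3 : Integrable (fun z : (ℝ × ℝ) × (ℝ × ℝ) =>
      t⁻¹ * exp (-(π * nsq (z.1 - z.2) / t)) * (‖f z.1‖ * ‖f z.2‖)) := by
    have hc : Continuous fun z : (ℝ × ℝ) × (ℝ × ℝ) => ‖f z.1‖ * ‖f z.2‖ :=
      (f.continuous.norm.comp continuous_fst).mul (f.continuous.norm.comp continuous_snd)
    refine ((ff_integrable f).const_mul t⁻¹).mono' (Continuous.aestronglyMeasurable (by fun_prop))
      (Filter.Eventually.of_forall fun z => ?_)
    rw [Real.norm_of_nonneg (by positivity), mul_assoc]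
    have : exp (-(π * nsq (z.1 - z.2) / t)) ≤ 1 := by
      rw [Real.exp_le_one_iff]
      have := nsq_nonneg (z.1 - z.2)
      have hp := Real.pi_pos
      rw [neg_nonpos]
      positivity
    exact mul_le_mul_of_nonneg_left (mul_le_of_le_one_left (by positivity) this) (by positivity)
  have hle : ∫ z : (ℝ × ℝ) × (ℝ × ℝ),
      t⁻¹ * exp (-(π * nsq (z.1 - z.2) / t)) * inner ℝ (f z.1) (f z.2) ≤
      ∫ z : (ℝ × ℝ) × (ℝ × ℝ), t⁻¹ * exp (-(π * nsq (z.1 - z.2) / t)) * (‖f z.1‖ * ‖f z.2‖) := by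
    apply integral_mono hI2 hI3
    intro z
    have := real_inner_le_norm (f z.1) (f z.2)
    simp only
    gcongr
  refine (ENNReal.ofReal_le_ofReal hle).trans ?_
  rw [ofReal_integral_eq_lintegral_ofReal hI3 (Filter.Eventually.of_forall fun ω => by positivity)]
  have hm : Measurable (fun z : (ℝ × ℝ) × (ℝ × ℝ) => wk f t z.1 z.2) :=
    wk_meas f measurable_const measurable_fst measurable_snd
  have hm2 : Measurable (fun z : (ℝ × ℝ) × (ℝ × ℝ) => wk f t z.2 z.1) :=
    wk_meas f measurable_const measurable_snd measurable_fst
  have hJ : ∫⁻ z : (ℝ × ℝ) × (ℝ × ℝ), wk f t z.1 z.2 = ∫⁻ x, ∫⁻ y, wk f t x y := by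
    rw [Measure.volume_eq_prod, lintegral_prod _ hm.aemeasurable]
  have hJ2 : ∫⁻ z : (ℝ × ℝ) × (ℝ × ℝ), wk f t z.2 z.1 = ∫⁻ x, ∫⁻ y, wk f t x y := by
    rw [Measure.volume_eq_prod, lintegral_prod_symm _ hm2.aemeasurable]
  calc _ ≤ ∫⁻ z : (ℝ × ℝ) × (ℝ × ℝ), (ENNReal.ofReal (1/2) * wk f t z.1 z.2 +
            ENNReal.ofReal (1/2) * wk f t z.2 z.1) := by
        apply lintegral_mono_ae
        have a1 : ∀ᵐ z : (ℝ × ℝ) × (ℝ × ℝ), z.1 ≠ 0 :=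
          Measure.quasiMeasurePreserving_fst.ae ae_ne_zero
        have a2 : ∀ᵐ z : (ℝ × ℝ) × (ℝ × ℝ), z.2 ≠ 0 :=
          Measure.quasiMeasurePreserving_snd.ae ae_ne_zero
        filter_upwards [a1, a2] with z h1 h2
        exact amgm f ht h1 h2
    _ = _ := by
        rw [lintegral_add_left (hm.const_mul _), lintegral_const_mul' _ _ ENNReal.ofReal_ne_top,
          lintegral_const_mul' _ _ ENNReal.ofReal_ne_top, hJ, hJ2, ← add_mul,
          ← ENNReal.ofReal_add (by norm_num) (by norm_num)]
        norm_num

/-- Constant in Pitt's inequality -/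
def pittC (a : ℝ) : ℝ := π ^ (2 * a) * (Gamma (1/2 - a) / Gamma (1/2 + a))

lemma pitt (f : SchwartzMap (ℝ × ℝ) (Quaternion ℝ)) {a : ℝ} (ha : 0 < a) (ha2 : a < 1/2) :
    ∫⁻ ω, ENNReal.ofReal (nsq ω ^ (-a) * ‖QFT f ω‖ ^ 2) ≤
      ENNReal.ofReal (pittC a) * ∫⁻ x, ENNReal.ofReal (nsq x ^ a * ‖f x‖ ^ 2) := by
  have hp := Real.pi_pos
  have hG1 := Real.Gamma_pos_of_pos (by linarith : 0 < 1/2 - a)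
  have hG2 := Real.Gamma_pos_of_pos (by linarith : 0 < 1/2 + a)
  have hG3 := Real.Gamma_pos_of_pos ha
  have hF := qft_cont f
  have hf := f.continuous
  have L1 : ENNReal.ofReal (Gamma a * π ^ (-a)) *
      ∫⁻ ω, ENNReal.ofReal (nsq ω ^ (-a) * ‖QFT f ω‖ ^ 2) =
      ∫⁻ t in Set.Ioi (0:ℝ), ENNReal.ofReal (t ^ (a - 1)) *
        ∫⁻ ω, ENNReal.ofReal (exp (-(π * t * nsq ω)) * ‖QFT f ω‖ ^ 2) := by
    rw [← lintegral_const_mul' _ _ ENNReal.ofReal_ne_top]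
    simp_rw [← lintegral_const_mul' _ _ ENNReal.ofReal_ne_top]
    rw [lintegral_lintegral_swap (by
      apply Measurable.aemeasurable; unfold Function.uncurry
      have : Measurable fun p : ℝ × (ℝ × ℝ) => ‖QFT f p.2‖ :=
        (hF.norm.comp continuous_snd).measurable
      fun_prop)]
    apply lintegral_congr_ae
    filter_upwards [ae_ne_zero] with ω hω
    have hn := nsq_pos hω
    have h1 : ∀ t ∈ Set.Ioi (0:ℝ), ENNReal.ofReal (t ^ (a - 1)) *
        ENNReal.ofReal (exp (-(π * t * nsq ω)) * ‖QFT f ω‖ ^ 2) =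
        ENNReal.ofReal (‖QFT f ω‖ ^ 2) *
          ENNReal.ofReal (t ^ (a - 1) * exp (-(π * nsq ω * t))) := by
      intro t ht
      have ht : 0 < t := ht
      rw [← ENNReal.ofReal_mul (by positivity), ← ENNReal.ofReal_mul (by positivity)]
      congr 1
      rw [show π * t * nsq ω = π * nsq ω * t by ring]; ring
    rw [setLIntegral_congr_fun measurableSet_Ioi h1,
      lintegral_const_mul' _ _ ENNReal.ofReal_ne_top, lint_gamma ha (by positivity),
      ← ENNReal.ofReal_mul (by positivity), ← ENNReal.ofReal_mul (by positivity)]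
    congr 1
    rw [one_div, Real.inv_rpow (by positivity), ← Real.rpow_neg (by positivity),
      Real.mul_rpow hp.le hn.le]
    ring
  have L2 : ∫⁻ t in Set.Ioi (0:ℝ), ENNReal.ofReal (t ^ (a - 1)) *
        ∫⁻ ω, ENNReal.ofReal (exp (-(π * t * nsq ω)) * ‖QFT f ω‖ ^ 2) ≤
      ∫⁻ t in Set.Ioi (0:ℝ), ENNReal.ofReal (t ^ (a - 1)) * ∫⁻ x, ∫⁻ y, wk f t x y := by
    apply setLIntegral_mono' measurableSet_Ioi
    intro t ht
    exact mul_le_mul_right (gauss_qft_le f ht) _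
  have L3 : ∫⁻ t in Set.Ioi (0:ℝ), ENNReal.ofReal (t ^ (a - 1)) * ∫⁻ x, ∫⁻ y, wk f t x y =
      ENNReal.ofReal (Gamma a * π ^ a * (Gamma (1/2 - a) / Gamma (1/2 + a))) *
        ∫⁻ x, ENNReal.ofReal (nsq x ^ a * ‖f x‖ ^ 2) := by
    simp_rw [← lintegral_const_mul' _ _ ENNReal.ofReal_ne_top]
    rw [lintegral_lintegral_swap]
    · apply lintegral_congr_ae
      filter_upwards [ae_ne_zero] with x hx
      have hn := nsq_pos hx
      have h1 : ∀ t ∈ Set.Ioi (0:ℝ), ∫⁻ y, ENNReal.ofReal (t ^ (a - 1)) * wk f t x y =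
        ENNReal.ofReal (‖f x‖ ^ 2 * nsq x ^ (1/2 : ℝ)) * ∫⁻ y : ℝ × ℝ,
      ENNReal.ofReal (t ^ (a - 1)) * (ENNReal.ofReal (t⁻¹ * exp (-(π * nsq (x - y) / t))) *
        ENNReal.ofReal (nsq y ^ (-(1/2) : ℝ))) := by
        intro t ht
        rw [← lintegral_const_mul' _ _ ENNReal.ofReal_ne_top]
        apply lintegral_congr
        intro y
        unfold wk
        ring
      rw [setLIntegral_congr_fun measurableSet_Ioi h1,
        lintegral_const_mul' _ _ ENNReal.ofReal_ne_top, schur_const ha ha2 hx,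
        ← ENNReal.ofReal_mul (by positivity), ← ENNReal.ofReal_mul (by positivity)]
      congr 1
      rw [show nsq x ^ a = nsq x ^ (1/2 : ℝ) * nsq x ^ (a - 1/2) by
        rw [← Real.rpow_add hn]; congr 1; ring]
      ring
    · apply Measurable.aemeasurable
      unfold Function.uncurry
      have hm : Measurable fun q : (ℝ × (ℝ × ℝ)) × (ℝ × ℝ) =>
          ENNReal.ofReal (q.1.1 ^ (a - 1)) * wk f q.1.1 q.1.2 q.2 := by
        have h1 : Measurable fun q : (ℝ × (ℝ × ℝ)) × (ℝ × ℝ) =>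
          ENNReal.ofReal (q.1.1 ^ (a - 1)) := by fun_prop
        exact h1.mul (wk_meas f (by fun_prop) (by fun_prop) (by fun_prop))
      exact hm.lintegral_prod_right'
  have key := (L1.le.trans L2).trans L3.le
  have hc : ENNReal.ofReal (Gamma a * π ^ a * (Gamma (1/2 - a) / Gamma (1/2 + a))) =
      ENNReal.ofReal (Gamma a * π ^ (-a)) * ENNReal.ofReal (pittC a) := by
    rw [← ENNReal.ofReal_mul (by positivity)]
    congr 1
    unfold pittC
    rw [show π ^ a = π ^ (-a) * π ^ (2 * a) by rw [← Real.rpow_add hp]; congr 1; ring]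
    ring
  rw [hc, mul_assoc] at key
  refine (ENNReal.mul_le_mul_iff_right ?_ ENNReal.ofReal_ne_top).mp key
  simp only [ne_eq, ENNReal.ofReal_eq_zero, not_le]
  positivity

lemma plancherel_limit (f : SchwartzMap (ℝ × ℝ) (Quaternion ℝ)) {s : ℝ} (hs : 0 < s) :
    ∫ ω, exp (-(π * s ^ 2 * nsq ω)) * ‖QFT f ω‖ ^ 2 =
      ∫ p : (ℝ × ℝ) × (ℝ × ℝ), exp (-(π * nsq p.2)) * inner ℝ (f p.1) (f (p.1 - s • p.2)) := by
  obtain ⟨-, hI2, hE⟩ := gauss_qft f (t := s ^ 2) (by positivity)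
  rw [hE, Measure.volume_eq_prod, integral_prod _ hI2, integral_prod]
  · apply integral_congr_ae
    refine Filter.Eventually.of_forall fun x => ?_
    simp only
    rw [← integral_sub_left_eq_self _ _ x]
    have h := Measure.integral_comp_smul (volume : Measure (ℝ × ℝ))
      (fun u => exp (-(π * nsq u / s ^ 2)) * inner ℝ (f x) (f (x - u))) s
    have h1 : ∀ z : ℝ × ℝ, nsq (s • z) / s ^ 2 = nsq z := by
      intro z
      simp only [nsq, Prod.smul_fst, Prod.smul_snd, smul_eq_mul]
      field_simp
    simp only [mul_div_assoc, h1] at h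
    rw [h]
    simp only [sub_sub_cancel, Module.finrank_prod, Module.finrank_self, mul_assoc,
      integral_const_mul, smul_eq_mul, mul_div_assoc]
    rw [abs_of_pos (by positivity)]
  · obtain ⟨C, hC⟩ : ∃ C, ∀ x, ‖f x‖ ≤ C := by
      obtain ⟨C, hC⟩ := f.decay 0 0
      exact ⟨C, fun x => by simpa using hC.2 x⟩
    have hg := gauss2_integrable one_pos
    simp only [mul_one] at hg
    refine ((f.integrable.norm.mul_prod hg).const_mul C).mono' ?_
      (Filter.Eventually.of_forall fun p => ?_)
    · have hf := f.continuous
      exact Continuous.aestronglyMeasurable (by fun_prop)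
    · rw [norm_mul, Real.norm_of_nonneg (Real.exp_pos _).le]
      calc _ ≤ exp (-(π * nsq p.2)) * (‖f p.1‖ * C) := by
            gcongr
            refine (norm_inner_le_norm _ _).trans ?_
            gcongr
            exact hC _
        _ = _ := by ring

lemma plancherel_le (f : SchwartzMap (ℝ × ℝ) (Quaternion ℝ))
    (hF : Integrable (fun ω => ‖QFT f ω‖ ^ 2)) :
    ∫ x, ‖f x‖ ^ 2 ≤ ∫ ω, ‖QFT f ω‖ ^ 2 := by
  have hf := f.continuous
  have hp := Real.pi_pos
  have hg := gauss2_integrable one_pos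
  simp only [mul_one] at hg
  obtain ⟨C, hC⟩ : ∃ C, ∀ x, ‖f x‖ ≤ C := by
    obtain ⟨C, hC⟩ := f.decay 0 0
    exact ⟨C, fun x => by simpa using hC.2 x⟩
  have hT : Filter.Tendsto (fun s : ℝ => ∫ p : (ℝ × ℝ) × (ℝ × ℝ),
      exp (-(π * nsq p.2)) * inner ℝ (f p.1) (f (p.1 - s • p.2))) (nhdsWithin 0 (Set.Ioi 0))
      (nhds (∫ p : (ℝ × ℝ) × (ℝ × ℝ),
        exp (-(π * nsq p.2)) * inner ℝ (f p.1) (f (p.1 - (0:ℝ) • p.2)))) := by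
    refine tendsto_integral_filter_of_dominated_convergence
      (fun p => C * (‖f p.1‖ * exp (-(π * nsq p.2)))) ?_ ?_
      ((f.integrable.norm.mul_prod hg).const_mul C) ?_
    · refine Filter.Eventually.of_forall fun s => Continuous.aestronglyMeasurable (by fun_prop)
    · refine Filter.Eventually.of_forall fun s => Filter.Eventually.of_forall fun p => ?_
      rw [norm_mul, Real.norm_of_nonneg (Real.exp_pos _).le]
      calc _ ≤ exp (-(π * nsq p.2)) * (‖f p.1‖ * C) := by
            gcongr
            refine (norm_inner_le_norm _ _).trans ?_
            gcongr
            exact hC _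
        _ = _ := by ring
    · refine Filter.Eventually.of_forall fun p => ?_
      have : Continuous fun s : ℝ =>
          exp (-(π * nsq p.2)) * inner ℝ (f p.1) (f (p.1 - s • p.2)) := by fun_prop
      exact (this.tendsto 0).mono_left nhdsWithin_le_nhds
  have hval : ∫ p : (ℝ × ℝ) × (ℝ × ℝ),
        exp (-(π * nsq p.2)) * inner ℝ (f p.1) (f (p.1 - (0:ℝ) • p.2)) = ∫ x, ‖f x‖ ^ 2 := by
    have e : ∀ p : (ℝ × ℝ) × (ℝ × ℝ),
        exp (-(π * nsq p.2)) * inner ℝ (f p.1) (f (p.1 - (0:ℝ) • p.2)) =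
        ‖f p.1‖ ^ 2 * exp (-(π * nsq p.2)) := by
      intro p
      rw [zero_smul, sub_zero, real_inner_self_eq_norm_sq, mul_comm]
    simp_rw [e]
    rw [Measure.volume_eq_prod,
      integral_prod_mul (fun x => ‖f x‖ ^ 2) (fun z => exp (-(π * nsq z)))]
    have : ∫ z : ℝ × ℝ, exp (-(π * nsq z)) = 1 := by
      have h := gauss_inner one_pos (fun _ => (1 : Quaternion ℝ)) 0 0
      simpa [nsq, real_inner_self_eq_norm_sq, norm_ker] using h
    rw [this, mul_one]
  rw [hval] at hT
  refine le_of_tendsto hT ?_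
  filter_upwards [self_mem_nhdsWithin] with s hs
  have hs : 0 < s := hs
  rw [← plancherel_limit f hs]
  refine integral_mono (gauss_qft f (by positivity)).1 hF fun ω => ?_
  simp only
  apply mul_le_of_le_one_left (by positivity)
  rw [Real.exp_le_one_iff, neg_nonpos]
  have := nsq_nonneg ω
  positivity

lemma int1 : Integrable (fun x : ℝ => |x| ^ (-(1/2) : ℝ) * (1 + x ^ 2)⁻¹) := by
  have h1 : Integrable (fun x : ℝ => |x| ^ ((1/2 : ℝ) - 1) * exp (-(1 * |x|))) := by
    apply Integrable.of_integral_ne_zero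
    rw [integral_comp_abs (f := fun x : ℝ => x ^ ((1/2 : ℝ) - 1) * exp (-(1 * x))),
      integral_rpow_mul_exp_neg_mul_Ioi (by norm_num) one_pos, Real.Gamma_one_half_eq]
    have := Real.pi_pos
    positivity
  refine (integrable_inv_one_add_sq.add (h1.const_mul (exp 1))).mono'
    (by apply Measurable.aestronglyMeasurable; fun_prop) (Filter.Eventually.of_forall fun x => ?_)
  rw [Real.norm_of_nonneg (by positivity)]
  simp only [Pi.add_apply]
  rw [show (1/2 : ℝ) - 1 = -(1/2) by norm_num]
  have h0 : 0 ≤ |x| ^ (-(1/2) : ℝ) := by positivity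
  have h2 : 0 ≤ (1 + x ^ 2)⁻¹ := by positivity
  have h3 : (1 + x ^ 2)⁻¹ ≤ 1 := inv_le_one_of_one_le₀ (by nlinarith [sq_nonneg x])
  rcases le_total |x| 1 with h | h
  · have : 1 ≤ exp 1 * exp (-(1 * |x|)) := by
      rw [← Real.exp_add, Real.one_le_exp_iff]; linarith
    calc |x| ^ (-(1/2) : ℝ) * (1 + x ^ 2)⁻¹ ≤ |x| ^ (-(1/2) : ℝ) * 1 := by gcongr
      _ ≤ |x| ^ (-(1/2) : ℝ) * (exp 1 * exp (-(1 * |x|))) := by gcongr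
      _ ≤ _ := by nlinarith
  · have : |x| ^ (-(1/2) : ℝ) ≤ 1 := Real.rpow_le_one_of_one_le_of_nonpos h (by norm_num)
    calc |x| ^ (-(1/2) : ℝ) * (1 + x ^ 2)⁻¹ ≤ 1 * (1 + x ^ 2)⁻¹ := by gcongr
      _ ≤ _ := by
        rw [one_mul]
        have : 0 ≤ exp 1 * (|x| ^ (-(1/2) : ℝ) * exp (-(1 * |x|))) := by positivity
        linarith

lemma abs_log_le {x : ℝ × ℝ} (hx : x.1 ≠ 0) :
    |Real.log (nsq x)| ≤ (1 + x.1 ^ 2) * (1 + x.2 ^ 2) + 4 * |x.1| ^ (-(1/2) : ℝ) := by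
  have h1 : 0 < x.1 ^ 2 := by positivity
  have hle : x.1 ^ 2 ≤ nsq x := by unfold nsq; nlinarith [sq_nonneg x.2]
  have hn : 0 < nsq x := lt_of_lt_of_le h1 hle
  have h0 : 0 ≤ |x.1| ^ (-(1/2) : ℝ) := by positivity
  have h2 : Real.log (nsq x) ≤ (1 + x.1 ^ 2) * (1 + x.2 ^ 2) := by
    have := Real.log_le_sub_one_of_pos hn
    have : nsq x ≤ (1 + x.1 ^ 2) * (1 + x.2 ^ 2) := by
      unfold nsq; nlinarith [mul_nonneg (sq_nonneg x.1) (sq_nonneg x.2)]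
    linarith
  have h3 : -Real.log (nsq x) ≤ 4 * |x.1| ^ (-(1/2) : ℝ) := by
    have a1 : Real.log (x.1 ^ 2) ≤ Real.log (nsq x) := Real.log_le_log h1 hle
    have a2 : Real.log (|x.1| ^ (-(1/2) : ℝ)) = -(1/2) * Real.log |x.1| :=
      Real.log_rpow (by positivity) _
    have a3 := Real.log_le_sub_one_of_pos (by positivity : 0 < |x.1| ^ (-(1/2) : ℝ))
    have a4 : Real.log (x.1 ^ 2) = 2 * Real.log |x.1| := by
      rw [← sq_abs, Real.log_pow]; norm_num
    linarith
  rw [abs_le]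
  constructor
  · have : 0 ≤ (1 + x.1 ^ 2) * (1 + x.2 ^ 2) := by positivity
    linarith
  · linarith

lemma ae_fst_ne_zero : ∀ᵐ x : ℝ × ℝ, x.1 ≠ 0 :=
  Measure.quasiMeasurePreserving_fst.ae (Measure.ae_ne (volume : Measure ℝ) 0)

lemma log_integrable {p : ℝ × ℝ → ℝ} (hp : Continuous p) {C : ℝ}
    (hC : ∀ x, |p x| * ((1 + x.1 ^ 2) * (1 + x.2 ^ 2)) ^ 2 ≤ C) :
    Integrable p ∧ Integrable (fun x => Real.log (nsq x) * p x) := by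
  have hC0 : 0 ≤ C := le_trans (by positivity) (hC 0)
  have i1 : Integrable (fun x : ℝ × ℝ => (1 + x.1 ^ 2)⁻¹ * (1 + x.2 ^ 2)⁻¹) :=
    integrable_inv_one_add_sq.mul_prod integrable_inv_one_add_sq
  have i2 : Integrable (fun x : ℝ × ℝ => |x.1| ^ (-(1/2) : ℝ) * (1 + x.1 ^ 2)⁻¹ *
      (1 + x.2 ^ 2)⁻¹) := int1.mul_prod integrable_inv_one_add_sq
  have hb : ∀ x : ℝ × ℝ, |p x| ≤ C * ((1 + x.1 ^ 2)⁻¹ * (1 + x.2 ^ 2)⁻¹) ^ 2 := by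
    intro x
    rw [← mul_inv, inv_pow, ← div_eq_mul_inv, le_div_iff₀ (by positivity)]
    exact hC x
  have hw : ∀ x : ℝ × ℝ, (1 + x.1 ^ 2)⁻¹ * (1 + x.2 ^ 2)⁻¹ ≤ 1 := by
    intro x
    rw [← mul_inv]
    apply inv_le_one_of_one_le₀
    nlinarith [sq_nonneg x.1, sq_nonneg x.2, mul_nonneg (sq_nonneg x.1) (sq_nonneg x.2)]
  have hb1 : ∀ x : ℝ × ℝ, |p x| ≤ C * ((1 + x.1 ^ 2)⁻¹ * (1 + x.2 ^ 2)⁻¹) := by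
    intro x
    refine (hb x).trans ?_
    gcongr
    rw [sq]
    exact mul_le_of_le_one_left (by positivity) (hw x)
  constructor
  · exact (i1.const_mul C).mono' hp.aestronglyMeasurable (Filter.Eventually.of_forall hb1)
  · refine ((i1.const_mul C).add (i2.const_mul (4 * C))).mono'
      (Measurable.aestronglyMeasurable ?_) ?_
    · have := hp.measurable
      exact (Real.measurable_log.comp measurable_nsq).mul this
    · filter_upwards [ae_fst_ne_zero] with x hx
      rw [norm_mul, Real.norm_eq_abs, Real.norm_eq_abs, Pi.add_apply]
      have h0 : 0 ≤ |x.1| ^ (-(1/2) : ℝ) := by positivity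
      calc _ ≤ ((1 + x.1 ^ 2) * (1 + x.2 ^ 2) + 4 * |x.1| ^ (-(1/2) : ℝ)) * |p x| := by
            gcongr; exact abs_log_le hx
        _ = (1 + x.1 ^ 2) * (1 + x.2 ^ 2) * |p x| + 4 * |x.1| ^ (-(1/2) : ℝ) * |p x| := by ring
        _ ≤ (1 + x.1 ^ 2) * (1 + x.2 ^ 2) * (C * ((1 + x.1 ^ 2)⁻¹ * (1 + x.2 ^ 2)⁻¹) ^ 2) +
            4 * |x.1| ^ (-(1/2) : ℝ) * (C * ((1 + x.1 ^ 2)⁻¹ * (1 + x.2 ^ 2)⁻¹)) := by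
            gcongr
            · exact hb x
            · exact hb1 x
        _ = _ := by
            congr 1
            · field_simp
            · ring

lemma hasDerivAt_expI (θ : ℝ) : HasDerivAt expI (qi * expI θ) θ := by
  have : expI = fun θ => Real.cos θ • (1 : Quaternion ℝ) + Real.sin θ • qi := funext expI_eq
  have h := ((Real.hasDerivAt_cos θ).smul_const (1 : Quaternion ℝ)).add
    ((Real.hasDerivAt_sin θ).smul_const qi)
  have e : qi * expI θ = -Real.sin θ • (1 : Quaternion ℝ) + Real.cos θ • qi := by
    ext <;> simp [re_expI, imI_expI, imJ_expI, imK_expI, re_qi, imI_qi, imJ_qi, imK_qi,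
      Quaternion.re_one, Quaternion.imI_one, Quaternion.imJ_one, Quaternion.imK_one]
  rw [e, this]
  exact h

lemma hasDerivAt_expJ (θ : ℝ) : HasDerivAt expJ (expJ θ * qj) θ := by
  have : expJ = fun θ => Real.cos θ • (1 : Quaternion ℝ) + Real.sin θ • qj := funext expJ_eq
  have h := ((Real.hasDerivAt_cos θ).smul_const (1 : Quaternion ℝ)).add
    ((Real.hasDerivAt_sin θ).smul_const qj)
  have e : expJ θ * qj = -Real.sin θ • (1 : Quaternion ℝ) + Real.cos θ • qj := by
    ext <;> simp [re_expJ, imI_expJ, imJ_expJ, imK_expJ, re_qj, imI_qj, imJ_qj, imK_qj,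
      Quaternion.re_one, Quaternion.imI_one, Quaternion.imJ_one, Quaternion.imK_one]
  rw [e, this]
  exact h

lemma norm_qi : ‖qi‖ = 1 := by
  have h : ‖qi‖ * ‖qi‖ = 1 := by
    rw [← Quaternion.normSq_eq_norm_mul_self, Quaternion.normSq_def']
    simp [re_qi, imI_qi, imJ_qi, imK_qi]
  nlinarith [norm_nonneg qi]

lemma norm_qj : ‖qj‖ = 1 := by
  have h : ‖qj‖ * ‖qj‖ = 1 := by
    rw [← Quaternion.normSq_eq_norm_mul_self, Quaternion.normSq_def']
    simp [re_qj, imI_qj, imJ_qj, imK_qj]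
  nlinarith [norm_nonneg qj]

lemma hasLine_f (f : SchwartzMap (ℝ × ℝ) (Quaternion ℝ)) (x v : ℝ × ℝ) :
    HasLineDerivAt ℝ f (LineDeriv.lineDerivOp v f x) x v := by
  rw [SchwartzMap.lineDerivOp_apply]
  exact f.differentiableAt.lineDifferentiableAt.hasLineDerivAt

lemma qft_deriv1 (f : SchwartzMap (ℝ × ℝ) (Quaternion ℝ)) (ω : ℝ × ℝ) :
    QFT (LineDeriv.lineDerivOp ((1 : ℝ), (0 : ℝ)) f : SchwartzMap (ℝ × ℝ) (Quaternion ℝ)) ω =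
      (2 * π * ω.1) • (qi * QFT f ω) := by
  set g : SchwartzMap (ℝ × ℝ) (Quaternion ℝ) := LineDeriv.lineDerivOp ((1 : ℝ), (0 : ℝ)) f with hg
  have hI := ker_integrable f ω
  have h2 : Integrable (fun x => (-(2 * π * ω.1)) • (qi * ker f ω x)) :=
    (hI.const_mul qi).smul (-(2 * π * ω.1))
  have key := integral_bilinear_hasLineDerivAt_right_eq_neg_left_of_integrable
    (μ := (volume : Measure (ℝ × ℝ))) (B := ContinuousLinearMap.mul ℝ (Quaternion ℝ))
    (v := ((1 : ℝ), (0 : ℝ)))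
    (f := fun x : ℝ × ℝ => expI (-(2 * π * x.1 * ω.1)))
    (f' := fun x : ℝ × ℝ => (-(2 * π * ω.1)) • (qi * expI (-(2 * π * x.1 * ω.1))))
    (g := fun x : ℝ × ℝ => f x * expJ (-(2 * π * x.2 * ω.2)))
    (g' := fun x : ℝ × ℝ => g x * expJ (-(2 * π * x.2 * ω.2)))
    (by
      refine h2.congr (Filter.Eventually.of_forall fun x => ?_)
      simp [ker, mul_assoc])
    (by
      refine (ker_integrable g ω).congr (Filter.Eventually.of_forall fun x => ?_)
      simp [ker, mul_assoc])
    (by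
      refine hI.congr (Filter.Eventually.of_forall fun x => ?_)
      simp [ker, mul_assoc])
    (by
      intro x _
      unfold HasLineDerivAt
      have h1 : HasDerivAt (fun t : ℝ => -(2 * π * (x.1 + t) * ω.1)) (-(2 * π * ω.1)) 0 := by
        have := ((((hasDerivAt_id (0 : ℝ)).const_add x.1).const_mul (2 * π)).mul_const ω.1).fun_neg
        simpa using this
      have := HasDerivAt.scomp (0 : ℝ) (h := fun t : ℝ => -(2 * π * (x.1 + t) * ω.1))
        (hasDerivAt_expI _) h1
      simpa [Function.comp_def] using this)
    (by
      intro x _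
      have h := hasLine_f f x (1, 0)
      unfold HasLineDerivAt at h ⊢
      have := h.mul_const (expJ (-(2 * π * x.2 * ω.2)))
      simpa using this)
  have e1 : QFT g ω = ∫ x, ker g ω x := rfl
  have e2 : QFT f ω = ∫ x, ker f ω x := rfl
  rw [e1, e2]
  have k1 : (∫ x, ker g ω x) = -∫ x, (-(2 * π * ω.1)) • (qi * ker f ω x) := by
    refine Eq.trans ?_ (key.trans ?_)
    · refine integral_congr_ae (Filter.Eventually.of_forall fun x => ?_)
      simp [ker, mul_assoc]
    · congr 1
      refine integral_congr_ae (Filter.Eventually.of_forall fun x => ?_)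
      simp [ker, mul_assoc]
  rw [k1, integral_smul, integral_const_mul_of_integrable hI]
  simp

lemma qft_deriv2 (f : SchwartzMap (ℝ × ℝ) (Quaternion ℝ)) (ω : ℝ × ℝ) :
    QFT (LineDeriv.lineDerivOp ((0 : ℝ), (1 : ℝ)) f : SchwartzMap (ℝ × ℝ) (Quaternion ℝ)) ω =
      (2 * π * ω.2) • (QFT f ω * qj) := by
  set g : SchwartzMap (ℝ × ℝ) (Quaternion ℝ) := LineDeriv.lineDerivOp ((0 : ℝ), (1 : ℝ)) f with hg
  have hI := ker_integrable f ω
  have h2 : Integrable (fun x => (-(2 * π * ω.2)) • (ker f ω x * qj)) :=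
    (hI.mul_const qj).smul (-(2 * π * ω.2))
  have key := integral_bilinear_hasLineDerivAt_right_eq_neg_left_of_integrable
    (μ := (volume : Measure (ℝ × ℝ))) (B := (ContinuousLinearMap.mul ℝ (Quaternion ℝ)).flip)
    (v := ((0 : ℝ), (1 : ℝ)))
    (f := fun x : ℝ × ℝ => expJ (-(2 * π * x.2 * ω.2)))
    (f' := fun x : ℝ × ℝ => (-(2 * π * ω.2)) • (expJ (-(2 * π * x.2 * ω.2)) * qj))
    (g := fun x : ℝ × ℝ => expI (-(2 * π * x.1 * ω.1)) * f x)
    (g' := fun x : ℝ × ℝ => expI (-(2 * π * x.1 * ω.1)) * g x)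
    (by
      refine h2.congr (Filter.Eventually.of_forall fun x => ?_)
      simp [ker, mul_assoc])
    (by
      refine (ker_integrable g ω).congr (Filter.Eventually.of_forall fun x => ?_)
      simp [ker, mul_assoc])
    (by
      refine hI.congr (Filter.Eventually.of_forall fun x => ?_)
      simp [ker, mul_assoc])
    (by
      intro x _
      unfold HasLineDerivAt
      have h1 : HasDerivAt (fun t : ℝ => -(2 * π * (x.2 + t) * ω.2)) (-(2 * π * ω.2)) 0 := by
        have := ((((hasDerivAt_id (0 : ℝ)).const_add x.2).const_mul (2 * π)).mul_const ω.2).fun_neg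
        simpa using this
      have := HasDerivAt.scomp (0 : ℝ) (h := fun t : ℝ => -(2 * π * (x.2 + t) * ω.2))
        (hasDerivAt_expJ _) h1
      simpa [Function.comp_def] using this)
    (by
      intro x _
      have h := hasLine_f f x (0, 1)
      unfold HasLineDerivAt at h ⊢
      have := h.const_mul (expI (-(2 * π * x.1 * ω.1)))
      simpa using this)
  have e1 : QFT g ω = ∫ x, ker g ω x := rfl
  have e2 : QFT f ω = ∫ x, ker f ω x := rfl
  rw [e1, e2]
  have k1 : (∫ x, ker g ω x) = -∫ x, (-(2 * π * ω.2)) • (ker f ω x * qj) := by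
    refine Eq.trans ?_ (key.trans ?_)
    · refine integral_congr_ae (Filter.Eventually.of_forall fun x => ?_)
      simp [ker, mul_assoc]
    · congr 1
      refine integral_congr_ae (Filter.Eventually.of_forall fun x => ?_)
      simp [ker, mul_assoc]
  rw [k1, integral_smul, integral_mul_const_of_integrable hI]
  simp

lemma qft_bound (f : SchwartzMap (ℝ × ℝ) (Quaternion ℝ)) (ω : ℝ × ℝ) :
    ‖QFT f ω‖ ≤ ∫ x, ‖f x‖ := by
  have e2 : QFT f ω = ∫ x, ker f ω x := rfl
  rw [e2]
  refine (norm_integral_le_integral_norm _).trans_eq ?_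
  simp only [norm_ker]

lemma qft_decay1 (n : ℕ) : ∀ f : SchwartzMap (ℝ × ℝ) (Quaternion ℝ),
    ∃ C, ∀ ω : ℝ × ℝ, |ω.1| ^ n * ‖QFT f ω‖ ≤ C := by
  induction n with
  | zero => intro f; exact ⟨_, fun ω => by simpa using qft_bound f ω⟩
  | succ n ih =>
    intro f
    obtain ⟨C, hC⟩ := ih (LineDeriv.lineDerivOp ((1 : ℝ), (0 : ℝ)) f)
    refine ⟨C, fun ω => le_trans ?_ (hC ω)⟩
    rw [qft_deriv1, norm_smul, norm_mul qi, norm_qi, norm_mul, norm_mul]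
    have : 1 ≤ 2 * π := by linarith [Real.pi_gt_three]
    simp only [Real.norm_eq_abs, abs_of_pos Real.pi_pos, abs_two]
    have h0 : 0 ≤ |ω.1| ^ (n+1) * ‖QFT f ω‖ := by positivity
    calc |ω.1| ^ (n+1) * ‖QFT f ω‖ ≤ (2 * π) * (|ω.1| ^ (n+1) * ‖QFT f ω‖) := by nlinarith
      _ = _ := by ring

lemma qft_decay2 (n : ℕ) : ∀ f : SchwartzMap (ℝ × ℝ) (Quaternion ℝ),
    ∃ C, ∀ ω : ℝ × ℝ, |ω.2| ^ n * ‖QFT f ω‖ ≤ C := by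
  induction n with
  | zero => intro f; exact ⟨_, fun ω => by simpa using qft_bound f ω⟩
  | succ n ih =>
    intro f
    obtain ⟨C, hC⟩ := ih (LineDeriv.lineDerivOp ((0 : ℝ), (1 : ℝ)) f)
    refine ⟨C, fun ω => le_trans ?_ (hC ω)⟩
    rw [qft_deriv2, norm_smul, norm_mul _ qj, norm_qj, norm_mul, norm_mul]
    have : 1 ≤ 2 * π := by linarith [Real.pi_gt_three]
    simp only [Real.norm_eq_abs, abs_of_pos Real.pi_pos, abs_two]
    have h0 : 0 ≤ |ω.2| ^ (n+1) * ‖QFT f ω‖ := by positivity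
    calc |ω.2| ^ (n+1) * ‖QFT f ω‖ ≤ (2 * π) * (|ω.2| ^ (n+1) * ‖QFT f ω‖) := by nlinarith
      _ = _ := by ring

lemma qft_int (f : SchwartzMap (ℝ × ℝ) (Quaternion ℝ)) :
    Integrable (fun ω => ‖QFT f ω‖ ^ 2) ∧
      Integrable (fun ω => Real.log (nsq ω) * ‖QFT f ω‖ ^ 2) := by
  obtain ⟨C0, h0⟩ := qft_decay1 0 f
  obtain ⟨C1, h1⟩ := qft_decay1 4 f
  obtain ⟨C2, h2⟩ := qft_decay2 4 f
  refine log_integrable (by have := qft_cont f; fun_prop)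
    (C := (2 * (C0 + C1 + C2)) ^ 2) (fun ω => ?_)
  have e1 : |ω.1| ^ 4 = ω.1 ^ 4 := Even.pow_abs (by decide) _
  have e2 : |ω.2| ^ 4 = ω.2 ^ 4 := Even.pow_abs (by decide) _
  have g0 := h0 ω
  have g1 := h1 ω
  have g2 := h2 ω
  rw [e1] at g1
  rw [e2] at g2
  rw [pow_zero, one_mul] at g0
  rw [abs_of_nonneg (by positivity), ← mul_pow]
  refine pow_le_pow_left₀ (by positivity) ?_ 2
  have : (1 + ω.1 ^ 2) * (1 + ω.2 ^ 2) ≤ 2 * (1 + ω.1 ^ 4 + ω.2 ^ 4) := by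
    nlinarith [sq_nonneg (ω.1 ^ 2 - ω.2 ^ 2), sq_nonneg (ω.1 ^ 2 - 1), sq_nonneg (ω.2 ^ 2 - 1)]
  calc ‖QFT f ω‖ * ((1 + ω.1 ^ 2) * (1 + ω.2 ^ 2))
      ≤ ‖QFT f ω‖ * (2 * (1 + ω.1 ^ 4 + ω.2 ^ 4)) := by gcongr
    _ ≤ _ := by linarith

lemma f_int (f : SchwartzMap (ℝ × ℝ) (Quaternion ℝ)) :
    Integrable (fun x => (1 + nsq x) * ‖f x‖ ^ 2) ∧
      Integrable (fun x => Real.log (nsq x) * ((1 + nsq x) * ‖f x‖ ^ 2)) := by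
  obtain ⟨C, hC⟩ : ∃ C, ∀ x, (1 + ‖x‖) ^ 5 * ‖f x‖ ≤ C := by
    refine ⟨2 ^ 5 * (Finset.Iic ((5, 0) : ℕ × ℕ)).sup
      (fun m => SchwartzMap.seminorm ℝ m.1 m.2) f, fun x => ?_⟩
    have := SchwartzMap.one_add_le_sup_seminorm_apply (𝕜 := ℝ) (m := (5, 0)) (k := 5) (n := 0)
      le_rfl le_rfl f x
    rwa [norm_iteratedFDeriv_zero] at this
  have hc := continuous_nsq
  have hf := f.continuous
  refine log_integrable (by fun_prop) (C := 2 * C ^ 2) (fun x => ?_)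
  have hn := nsq_nonneg x
  set r := ‖x‖ with hr
  have hr0 : 0 ≤ r := norm_nonneg _
  have a1 : x.1 ^ 2 ≤ r ^ 2 := by
    rw [← sq_abs]; exact pow_le_pow_left₀ (abs_nonneg _) (norm_fst_le x) 2
  have a2 : x.2 ^ 2 ≤ r ^ 2 := by
    rw [← sq_abs]; exact pow_le_pow_left₀ (abs_nonneg _) (norm_snd_le x) 2
  have b0 : 1 + r ^ 2 ≤ (1 + r) ^ 2 := by nlinarith
  have b1 : 1 + x.1 ^ 2 ≤ (1 + r) ^ 2 := by linarith
  have b2 : 1 + x.2 ^ 2 ≤ (1 + r) ^ 2 := by linarith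
  have b3 : 1 + nsq x ≤ 2 * (1 + r) ^ 2 := by unfold nsq; linarith
  have hp : 0 ≤ (1 + r) ^ 5 * ‖f x‖ := by positivity
  rw [abs_of_nonneg (by positivity)]
  calc (1 + nsq x) * ‖f x‖ ^ 2 * ((1 + x.1 ^ 2) * (1 + x.2 ^ 2)) ^ 2
      ≤ (2 * (1 + r) ^ 2) * ‖f x‖ ^ 2 * ((1 + r) ^ 2 * (1 + r) ^ 2) ^ 2 := by gcongr
    _ = 2 * ((1 + r) ^ 5 * ‖f x‖) ^ 2 := by ring
    _ ≤ 2 * C ^ 2 := by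
      have := pow_le_pow_left₀ hp (hC x) 2
      linarith

lemma pittC_deriv : HasDerivAt pittC
    (2 * Real.log π - 2 * (deriv Real.Gamma (1 / 2) / Real.Gamma (1 / 2))) 0 := by
  have hg : HasDerivAt Real.Gamma (deriv Real.Gamma (1 / 2)) (1 / 2) := by
    refine (Real.differentiableAt_Gamma fun m => ?_).hasDerivAt
    have : (0 : ℝ) ≤ m := Nat.cast_nonneg m
    linarith
  have hG : Real.Gamma (1 / 2) ≠ 0 := (Real.Gamma_pos_of_pos (by norm_num)).ne'
  have h1 : HasDerivAt (fun a : ℝ => Real.Gamma (1 / 2 - a)) (-deriv Real.Gamma (1 / 2)) 0 := by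
    have h := (hasDerivAt_id (0 : ℝ)).const_sub (1 / 2)
    have := HasDerivAt.comp (0 : ℝ) (h := fun a : ℝ => 1 / 2 - a) (h₂ := Real.Gamma)
      (h₂' := deriv Real.Gamma (1 / 2)) (by rw [sub_zero]; exact hg) h
    simpa [Function.comp_def] using this
  have h2 : HasDerivAt (fun a : ℝ => Real.Gamma (1 / 2 + a)) (deriv Real.Gamma (1 / 2)) 0 := by
    have h := (hasDerivAt_id (0 : ℝ)).const_add (1 / 2)
    have := HasDerivAt.comp (0 : ℝ) (h := fun a : ℝ => 1 / 2 + a) (h₂ := Real.Gamma)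
      (h₂' := deriv Real.Gamma (1 / 2)) (by rw [add_zero]; exact hg) h
    simpa [Function.comp_def] using this
  have h3 : HasDerivAt (fun a : ℝ => π ^ (2 * a)) (2 * Real.log π) 0 := by
    have h := ((hasDerivAt_id (0 : ℝ)).const_mul 2).const_rpow Real.pi_pos
    simp only [id, mul_zero, Real.rpow_zero, mul_one] at h
    convert h using 1
    ring
  have h := h3.fun_mul (h1.fun_div h2 (by simpa using hG))
  refine h.congr_deriv ?_
  simp only [mul_zero, Real.rpow_zero, sub_zero, add_zero]
  field_simp
  ring

lemma pittC_zero : pittC 0 = 1 := by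
  have hG : Real.Gamma (1 / 2) ≠ 0 := (Real.Gamma_pos_of_pos (by norm_num)).ne'
  simp only [pittC, mul_zero, Real.rpow_zero, sub_zero, add_zero, one_mul, div_self hG]

lemma quot_bound {n a : ℝ} (hn : 0 < n) (ha : 0 < a) (ha1 : a < 1) :
    |a⁻¹ * (n ^ a - 1)| ≤ |Real.log n| * (1 + n) := by
  rw [abs_mul, abs_of_pos (inv_pos.2 ha), inv_mul_le_iff₀ ha, Real.rpow_def_of_pos hn]
  rcases le_total 0 (Real.log n) with hl | hl
  · have h1 := Real.add_one_le_exp (-(Real.log n * a))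
    have h2 : exp (Real.log n * a) * exp (-(Real.log n * a)) = 1 := by
      rw [← Real.exp_add]; simp
    have h3 : 0 ≤ Real.log n * a := by positivity
    have h4 : exp (Real.log n * a) ≤ n := by
      conv_rhs => rw [← Real.exp_log hn]
      exact Real.exp_le_exp.2 (by nlinarith)
    have h5 := Real.one_le_exp h3
    rw [abs_of_nonneg (by linarith), abs_of_nonneg hl]
    have h6 : exp (Real.log n * a) - 1 ≤ (Real.log n * a) * exp (Real.log n * a) := by
      nlinarith [mul_le_mul_of_nonneg_left h1 (Real.exp_pos (Real.log n * a)).le]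
    have h7 := mul_le_mul_of_nonneg_left h4 h3
    nlinarith
  · have h3 : Real.log n * a ≤ 0 := by nlinarith
    have h1 := Real.add_one_le_exp (Real.log n * a)
    have h5 := Real.exp_le_one_iff.2 h3
    rw [abs_of_nonpos (by linarith), abs_of_nonpos hl]
    have : 0 ≤ (-(Real.log n * a)) * n := by apply mul_nonneg <;> linarith
    nlinarith

lemma f_int0 (f : SchwartzMap (ℝ × ℝ) (Quaternion ℝ)) : Integrable (fun x => ‖f x‖ ^ 2) := by
  have hf := f.continuous
  refine (f_int f).1.mono' (by fun_prop) (Filter.Eventually.of_forall fun x => ?_)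
  rw [Real.norm_of_nonneg (by positivity)]
  nlinarith [mul_nonneg (nsq_nonneg x) (sq_nonneg ‖f x‖)]

lemma f_inta (f : SchwartzMap (ℝ × ℝ) (Quaternion ℝ)) {a : ℝ} (ha : 0 < a) (ha1 : a < 1) :
    Integrable (fun x => nsq x ^ a * ‖f x‖ ^ 2) := by
  have hf := f.continuous
  have hn := measurable_nsq
  refine (f_int f).1.mono' ?_ (Filter.Eventually.of_forall fun x => ?_)
  · have : Measurable (fun x => nsq x ^ a * ‖f x‖ ^ 2) := by
      have : Measurable (fun x => ‖f x‖) := hf.norm.measurable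
      fun_prop
    exact this.aestronglyMeasurable
  · have h0 := nsq_nonneg x
    rw [Real.norm_of_nonneg (by positivity)]
    gcongr
    rcases le_total (nsq x) 1 with h | h
    · have := Real.rpow_le_one h0 h ha.le
      linarith
    · have := Real.rpow_le_rpow_of_exponent_le h ha1.le
      rw [Real.rpow_one] at this
      linarith

lemma M_tendsto (f : SchwartzMap (ℝ × ℝ) (Quaternion ℝ)) :
    Filter.Tendsto (fun a : ℝ => a⁻¹ * ((∫ x, nsq x ^ a * ‖f x‖ ^ 2) - ∫ x, ‖f x‖ ^ 2))
      (nhdsWithin 0 (Set.Ioi 0)) (nhds (∫ x, Real.log (nsq x) * ‖f x‖ ^ 2)) := by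
  have hf := f.continuous
  have hmem : ∀ᶠ a : ℝ in nhdsWithin 0 (Set.Ioi 0), 0 < a ∧ a < 1 :=
    Ioo_mem_nhdsGT (by norm_num : (0 : ℝ) < 1)
  have h : Filter.Tendsto (fun a : ℝ => ∫ x, a⁻¹ * (nsq x ^ a - 1) * ‖f x‖ ^ 2)
      (nhdsWithin 0 (Set.Ioi 0)) (nhds (∫ x, Real.log (nsq x) * ‖f x‖ ^ 2)) := by
    refine tendsto_integral_filter_of_dominated_convergence
      (fun x => |Real.log (nsq x) * ((1 + nsq x) * ‖f x‖ ^ 2)|) ?_ ?_ (f_int f).2.abs ?_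
    · refine Filter.Eventually.of_forall fun a => Measurable.aestronglyMeasurable ?_
      have : Measurable (fun x => ‖f x‖) := hf.norm.measurable
      have hn := measurable_nsq
      fun_prop
    · filter_upwards [hmem] with a ha
      filter_upwards [ae_ne_zero] with x hx
      have h := quot_bound (nsq_pos hx) ha.1 ha.2
      have h0 := nsq_nonneg x
      rw [Real.norm_eq_abs, abs_mul, abs_mul (Real.log _),
        abs_of_nonneg (by positivity : 0 ≤ (1 + nsq x) * ‖f x‖ ^ 2), ← mul_assoc,
        abs_of_nonneg (by positivity : 0 ≤ ‖f x‖ ^ 2)]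
      gcongr
    · filter_upwards [ae_ne_zero] with x hx
      refine Filter.Tendsto.mul_const _ ?_
      have hd := (Real.hasStrictDerivAt_const_rpow (nsq_pos hx) 0).hasDerivAt
      rw [hasDerivAt_iff_tendsto_slope_zero] at hd
      have := hd.mono_left (nhdsGT_le_nhdsNE 0)
      simpa using this
  refine h.congr' ?_
  filter_upwards [hmem] with a ha
  rw [← integral_sub (f_inta f ha.1 ha.2) (f_int0 f), ← integral_const_mul]
  refine integral_congr_ae (Filter.Eventually.of_forall fun x => ?_)
  ring

lemma pitt_real (f : SchwartzMap (ℝ × ℝ) (Quaternion ℝ)) {a : ℝ} (ha : 0 < a) (ha2 : a < 1 / 2) :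
    (∫ x, ‖f x‖ ^ 2) - a * (∫ ω, Real.log (nsq ω) * ‖QFT f ω‖ ^ 2) ≤
      pittC a * ∫ x, nsq x ^ a * ‖f x‖ ^ 2 := by
  obtain ⟨hF, hL⟩ := qft_int f
  have hpc : 0 ≤ pittC a := by
    have h1 := Real.Gamma_pos_of_pos (by linarith : 0 < 1 / 2 - a)
    have h2 := Real.Gamma_pos_of_pos (by linarith : 0 < 1 / 2 + a)
    unfold pittC
    have := Real.pi_pos
    positivity
  have hP := plancherel_le f hF
  have hM0 : 0 ≤ ∫ x, nsq x ^ a * ‖f x‖ ^ 2 := integral_nonneg fun x => by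
    have := nsq_nonneg x
    positivity
  have hi : Integrable (fun ω => ‖QFT f ω‖ ^ 2 - a * (Real.log (nsq ω) * ‖QFT f ω‖ ^ 2)) :=
    hF.sub (hL.const_mul a)
  have e : (∫ ω, ‖QFT f ω‖ ^ 2 - a * (Real.log (nsq ω) * ‖QFT f ω‖ ^ 2)) =
      (∫ ω, ‖QFT f ω‖ ^ 2) - a * (∫ ω, Real.log (nsq ω) * ‖QFT f ω‖ ^ 2) := by
    rw [integral_sub hF (hL.const_mul a), integral_const_mul]
  have h1 : (∫⁻ ω, ENNReal.ofReal (‖QFT f ω‖ ^ 2 - a * (Real.log (nsq ω) * ‖QFT f ω‖ ^ 2))) ≤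
      ENNReal.ofReal (pittC a * ∫ x, nsq x ^ a * ‖f x‖ ^ 2) := by
    rw [ENNReal.ofReal_mul hpc, ofReal_integral_eq_lintegral_ofReal
      (f_inta f ha (by linarith)) (Filter.Eventually.of_forall fun x => by
        have := nsq_nonneg x
        simp only [Pi.zero_apply]
        positivity)]
    refine le_trans (lintegral_mono_ae ?_) (pitt f ha ha2)
    filter_upwards [ae_ne_zero] with ω hω
    refine ENNReal.ofReal_le_ofReal ?_
    rw [Real.rpow_def_of_pos (nsq_pos hω)]
    have := Real.add_one_le_exp (Real.log (nsq ω) * -a)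
    nlinarith [mul_le_mul_of_nonneg_right this (sq_nonneg ‖QFT f ω‖)]
  have h2 : (∫ ω, ‖QFT f ω‖ ^ 2 - a * (Real.log (nsq ω) * ‖QFT f ω‖ ^ 2)) ≤
      pittC a * ∫ x, nsq x ^ a * ‖f x‖ ^ 2 := by
    rw [integral_eq_lintegral_pos_part_sub_lintegral_neg_part hi]
    refine (sub_le_self _ ENNReal.toReal_nonneg).trans ?_
    exact ENNReal.toReal_le_of_le_ofReal (mul_nonneg hpc hM0) h1
  linarith

theorem log_nsq (f : SchwartzMap (ℝ × ℝ) (Quaternion ℝ)) :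
    (2 * (deriv Real.Gamma (1 / 2) / Real.Gamma (1 / 2)) - 2 * Real.log π) * (∫ x, ‖f x‖ ^ 2) ≤
    (∫ x, Real.log (nsq x) * ‖f x‖ ^ 2) + ∫ ω, Real.log (nsq ω) * ‖QFT f ω‖ ^ 2 := by
  set N := ∫ x, ‖f x‖ ^ 2 with hN
  set LF := ∫ ω, Real.log (nsq ω) * ‖QFT f ω‖ ^ 2 with hLF
  set Lf := ∫ x, Real.log (nsq x) * ‖f x‖ ^ 2 with hLf
  set M : ℝ → ℝ := fun a => ∫ x, nsq x ^ a * ‖f x‖ ^ 2 with hM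
  set c := 2 * Real.log π - 2 * (deriv Real.Gamma (1 / 2) / Real.Gamma (1 / 2)) with hc
  have t1 : Filter.Tendsto (fun a => a⁻¹ * (M a - N)) (nhdsWithin 0 (Set.Ioi 0)) (nhds Lf) :=
    M_tendsto f
  have ta : Filter.Tendsto (fun a : ℝ => a) (nhdsWithin 0 (Set.Ioi 0)) (nhds 0) :=
    Filter.tendsto_id.mono_left nhdsWithin_le_nhds
  have hpos : ∀ᶠ a : ℝ in nhdsWithin 0 (Set.Ioi 0), 0 < a ∧ a < 1 / 2 :=
    Ioo_mem_nhdsGT (by norm_num : (0 : ℝ) < 1 / 2)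
  have t2 : Filter.Tendsto M (nhdsWithin 0 (Set.Ioi 0)) (nhds N) := by
    have := (ta.mul t1).add_const N
    rw [zero_mul, zero_add] at this
    refine this.congr' ?_
    filter_upwards [hpos] with a ha
    have := ha.1.ne'
    field_simp
    ring
  have t3 : Filter.Tendsto (fun a => a⁻¹ * (pittC a - 1)) (nhdsWithin 0 (Set.Ioi 0)) (nhds c) := by
    have hd := pittC_deriv
    rw [hasDerivAt_iff_tendsto_slope_zero] at hd
    have := hd.mono_left (nhdsGT_le_nhdsNE 0)
    simpa only [pittC_zero, zero_add, smul_eq_mul] using this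
  have t4 := (t3.mul t2).add t1
  have key : -LF ≤ c * N + Lf := by
    refine ge_of_tendsto t4 ?_
    filter_upwards [hpos] with a ha
    have h : N - a * LF ≤ pittC a * M a := pitt_real f ha.1 ha.2
    have : a⁻¹ * (pittC a - 1) * M a + a⁻¹ * (M a - N) = a⁻¹ * (pittC a * M a - N) := by ring
    rw [this, ← div_eq_inv_mul, le_div_iff₀ ha.1]
    linarith
  have : (2 * (deriv Real.Gamma (1 / 2) / Real.Gamma (1 / 2)) - 2 * Real.log π) * N = -(c * N) := by
    rw [hc]; ring
  linarith


/-- **Logarithmic uncertainty principle for the two-sided QFT.** For Schwartz `f : ℝ² → ℍ`,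
`∫ ln|x| |f(x)|² dx + ∫ ln|ω| |F_q f(ω)|² dω ≥ (Γ'(1/2)/Γ(1/2) - ln π) ∫ |f(x)|² dx`. -/
theorem qft_log_uncertainty (f : SchwartzMap (ℝ × ℝ) (Quaternion ℝ)) :
    (∫ x : ℝ × ℝ, Real.log (euclNorm x) * ‖f x‖ ^ 2) +
      ∫ ω : ℝ × ℝ, Real.log (euclNorm ω) * ‖QFT (⇑f) ω‖ ^ 2 ≥
      (deriv Real.Gamma (1 / 2) / Real.Gamma (1 / 2) - Real.log π) *
        ∫ x : ℝ × ℝ, ‖f x‖ ^ 2 := by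
  have h := log_nsq f
  have e : ∀ x, Real.log (euclNorm x) = (1 / 2) * Real.log (nsq x) := by
    intro x
    have : euclNorm x = √(nsq x) := rfl
    rw [this, Real.log_sqrt (nsq_nonneg x)]
    ring
  simp only [e, mul_assoc, integral_const_mul]
  linarith
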